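/- arXiv:1801.06331 — 10 statements merged into one kernel-verified Lean document; each statement's English description precedes it below -/
import Mathlib

section
/- There exists α with 0 < α < 1/2 such that for every integer d ≥ 2 and every real z with 0 ≤ z < √d·π/2, one has |B(z/√d)| = |cos^d(z/√d) − (d−1)·cos^{d−2}(z/√d)·sin²(z/√d)| ≤ (1 + z²) · exp(−α z²). -/
open Real

lemma cos_le_exp_neg_sq_div_five {x : ℝ} (hx : |x| ≤ π) : cos x ≤ exp (-(x ^ 2 / 5)) := by
  have hπ : π ^ 2 ≤ 10 := by nlinarith [pi_lt_d2, pi_pos]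
  have h : (1 : ℝ) / 5 ≤ 2 / π ^ 2 := by
    rw [div_le_div_iff₀ (by norm_num) (by positivity)]
    linarith
  calc cos x ≤ 1 - 2 / π ^ 2 * x ^ 2 := cos_le_one_sub_mul_cos_sq hx
    _ ≤ -(x ^ 2 / 5) + 1 := by nlinarith [sq_nonneg x]
    _ ≤ exp (-(x ^ 2 / 5)) := add_one_le_exp _

lemma one_le_one_add_mul_exp {x : ℝ} (hx0 : 0 ≤ x) (hx : x ≤ 14) :
    1 ≤ (1 + x) * exp (-(1 / 15) * x) := by
  calc 1 ≤ (1 + x) * (-(1 / 15) * x + 1) := by nlinarith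
    _ ≤ _ := by gcongr; exact add_one_le_exp _

/-- Bound for the covariance term `B(θ) = cos^d(θ) - (d-1) cos^{d-2}(θ) sin²(θ)` at
`θ = z/√d`: there is `0 < α < 1/2` such that `|B(z/√d)| ≤ (1+z²) exp(-α z²)` for all
`d ≥ 2` and `0 ≤ z < √d·π/2`. -/
theorem kss_bound_B :
    ∃ α : ℝ, 0 < α ∧ α < 1 / 2 ∧
      ∀ d : ℕ, 2 ≤ d → ∀ z : ℝ, 0 ≤ z → z < Real.sqrt d * π / 2 →
        |Real.cos (z / Real.sqrt d) ^ d
            - (d - 1 : ℝ) * Real.cos (z / Real.sqrt d) ^ (d - 2)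
              * Real.sin (z / Real.sqrt d) ^ 2|
          ≤ (1 + z ^ 2) * Real.exp (-α * z ^ 2) := by
  refine ⟨1 / 15, by norm_num, by norm_num, fun d hd z hz hzd => ?_⟩
  obtain ⟨n, rfl⟩ := Nat.exists_eq_add_of_le' hd
  have hs : 0 < √((n + 2 : ℕ) : ℝ) := sqrt_pos.2 (by positivity)
  set θ := z / √((n + 2 : ℕ) : ℝ) with hθ
  have hθ0 : 0 ≤ θ := by positivity
  have hθπ : θ < π / 2 := by
    rw [hθ, div_lt_iff₀ hs]
    linarith
  have hz2 : z ^ 2 = (n + 2) * θ ^ 2 := by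
    rw [hθ, div_pow, sq_sqrt (by positivity)]
    push_cast
    field_simp
  have hc : 0 ≤ cos θ := cos_nonneg_of_mem_Icc ⟨by linarith, hθπ.le⟩
  have hsin : sin θ ^ 2 ≤ θ ^ 2 := sin_sq_le_sq
  have hB : cos θ ^ (n + 2) - (((n + 2 : ℕ) : ℝ) - 1) * cos θ ^ (n + 2 - 2) * sin θ ^ 2
      = cos θ ^ n * (1 - (n + 2) * sin θ ^ 2) := by
    rw [Nat.add_sub_cancel, pow_add, cos_sq']
    push_cast
    ring
  rw [hB, abs_mul, abs_of_nonneg (pow_nonneg hc n)]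
  rcases Nat.eq_zero_or_pos n with rfl | hn
  · have hle : z ^ 2 ≤ 14 := by
      rw [hz2]
      push_cast
      nlinarith [pi_lt_d2]
    refine le_trans ?_ (one_le_one_add_mul_exp (sq_nonneg z) hle)
    rw [pow_zero, one_mul, abs_le]
    push_cast
    constructor <;> nlinarith [sin_sq_le_one θ, sq_nonneg (sin θ)]
  · have hn' : (1 : ℝ) ≤ n := by exact_mod_cast hn
    have hpow : cos θ ^ n ≤ exp (-(1 / 15) * z ^ 2) := by
      calc cos θ ^ n ≤ exp (-(θ ^ 2 / 5)) ^ n := by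
            gcongr
            exact cos_le_exp_neg_sq_div_five (abs_le.2 ⟨by linarith, by linarith⟩)
        _ = exp (n * -(θ ^ 2 / 5)) := (exp_nat_mul _ _).symm
        _ ≤ _ := by
            rw [hz2, exp_le_exp]
            nlinarith [mul_nonneg (sub_nonneg.2 hn') (sq_nonneg θ)]
    have hfac : |1 - (n + 2) * sin θ ^ 2| ≤ 1 + z ^ 2 := by
      have h1 : 0 ≤ (n + 2) * sin θ ^ 2 := by positivity
      have h2 : (n + 2) * sin θ ^ 2 ≤ z ^ 2 := by
        rw [hz2]
        gcongr
      rw [abs_le]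
      constructor <;> linarith
    rw [mul_comm]
    gcongr
end

section
/- There exists α with 0 < α < 1/2 such that for every integer d ≥ 2 and every real z with 0 ≤ z < √d·π/2, one has 0 ≤ C(z/√d) ≤ D(z/√d) ≤ exp(−α z²), where C(θ) = cos^d(θ) and D(θ) = cos^{d−1}(θ). -/
open Real

/-- Bound for the covariance terms `C(θ) = cos^d(θ)` and `D(θ) = cos^{d-1}(θ)` at
`θ = z/√d`: there is `0 < α < 1/2` such that
`0 ≤ C(z/√d) ≤ D(z/√d) ≤ exp(-α z²)` for all `d ≥ 2` and `0 ≤ z < √d·π/2`. -/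
theorem kss_bound_CD :
    ∃ α : ℝ, 0 < α ∧ α < 1 / 2 ∧
      ∀ d : ℕ, 2 ≤ d → ∀ z : ℝ, 0 ≤ z → z < Real.sqrt d * π / 2 →
        0 ≤ Real.cos (z / Real.sqrt d) ^ d ∧
        Real.cos (z / Real.sqrt d) ^ d ≤ Real.cos (z / Real.sqrt d) ^ (d - 1) ∧
        Real.cos (z / Real.sqrt d) ^ (d - 1) ≤ Real.exp (-α * z ^ 2) := by
  refine ⟨1 / π ^ 2, by positivity, ?_, fun d hd z hz0 hz ↦ ?_⟩
  · exact one_div_lt_one_div_of_lt two_pos (by nlinarith [pi_gt_three])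
  have hd2 : (2 : ℝ) ≤ d := by exact_mod_cast hd
  have hs : 0 < √(d : ℝ) := Real.sqrt_pos.mpr (by linarith)
  set θ := z / √(d : ℝ) with hθ
  have hθ0 : 0 ≤ θ := by positivity
  have hθ1 : θ ≤ π / 2 := by
    rw [hθ, div_le_iff₀ hs]
    linarith
  have hz2 : z ^ 2 = d * θ ^ 2 := by
    rw [hθ, div_pow, Real.sq_sqrt (by linarith)]
    field_simp
  have hcos : 0 ≤ cos θ := cos_nonneg_of_mem_Icc ⟨by linarith [pi_pos], hθ1⟩
  refine ⟨pow_nonneg hcos d, pow_le_pow_of_le_one hcos (cos_le_one θ) (Nat.sub_le d 1), ?_⟩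
  have hexp : cos θ ≤ exp (-(2 / π ^ 2 * θ ^ 2)) := by
    have hquad : cos θ ≤ 1 - 2 / π ^ 2 * θ ^ 2 :=
      cos_le_one_sub_mul_cos_sq (by rw [abs_of_nonneg hθ0]; linarith [pi_pos])
    linarith [add_one_le_exp (-(2 / π ^ 2 * θ ^ 2))]
  calc cos θ ^ (d - 1) ≤ exp (-(2 / π ^ 2 * θ ^ 2)) ^ (d - 1) := by gcongr
    _ = exp (((d : ℝ) - 1) * -(2 / π ^ 2 * θ ^ 2)) := by
      rw [← exp_nat_mul, Nat.cast_sub (by lia), Nat.cast_one]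
    _ ≤ exp (-(1 / π ^ 2) * z ^ 2) := by
      rw [exp_le_exp, hz2]
      have h : 0 ≤ (d - 2) * (1 / π ^ 2 * θ ^ 2) := mul_nonneg (by linarith) (by positivity)
      linear_combination h
end

section
/- There exist α with 0 < α < 1/2 and a constant K > 0 such that for every integer d ≥ 2 and every real z with 0 < z < √d·π/2, the quantity σ²(z/√d) = 1 − A(z/√d)²/(1 − C(z/√d)²) is well defined (i.e. C(z/√d)² < 1) and satisfies 0 ≤ 1 − σ²(z/√d) ≤ K · exp(−2α z²). -/
open Real

/-- AM-GM for a geometric sum, pairing each term with its mirror image. -/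
theorem natCast_mul_pow_pred_le_sum_sq_pow (d : ℕ) (x : ℝ) :
    (d : ℝ) * x ^ (d - 1) ≤ ∑ k ∈ Finset.range d, (x ^ 2) ^ k := by
  have hreflect := Finset.sum_range_reflect (fun k => (x ^ 2) ^ k) d
  have hsum : ∑ _k ∈ Finset.range d, 2 * x ^ (d - 1) ≤
      ∑ k ∈ Finset.range d, ((x ^ 2) ^ k + (x ^ 2) ^ (d - 1 - k)) := by
    refine Finset.sum_le_sum fun k hk => ?_
    have hk' : k + (d - 1 - k) = d - 1 := by
      have := Finset.mem_range.mp hk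
      omega
    rw [← hk', pow_add, add_tsub_cancel_left, ← pow_mul, ← pow_mul, mul_comm 2 k,
      mul_comm 2 (d - 1 - k), pow_mul, pow_mul, ← mul_assoc]
    exact two_mul_le_add_sq _ _
  rw [Finset.sum_add_distrib, hreflect, Finset.sum_const, Finset.card_range,
    nsmul_eq_mul] at hsum
  linarith

theorem natCast_mul_pow_pred_mul_one_sub_sq_le (d : ℕ) {x : ℝ} (hx : x ^ 2 ≤ 1) :
    (d : ℝ) * x ^ (d - 1) * (1 - x ^ 2) ≤ 1 - (x ^ d) ^ 2 := by
  have hgeom := geom_sum_mul_neg (x ^ 2) d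
  rw [← pow_mul, mul_comm 2 d, pow_mul] at hgeom
  rw [← hgeom]
  exact mul_le_mul_of_nonneg_right (natCast_mul_pow_pred_le_sum_sq_pow d x) (by linarith)

theorem cos_pow_le_exp_neg {x : ℝ} (hx : |x| ≤ π / 2) (n : ℕ) :
    cos x ^ n ≤ exp (-(n * (2 / π ^ 2 * x ^ 2))) := by
  have hcos : cos x ≤ exp (-(2 / π ^ 2 * x ^ 2)) := by
    have h₁ := cos_le_one_sub_mul_cos_sq (hx.trans (by linarith [pi_pos]))
    have h₂ := add_one_le_exp (-(2 / π ^ 2 * x ^ 2))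
    linarith
  have hpow := pow_le_pow_left₀
    (cos_nonneg_of_neg_pi_div_two_le_of_le (neg_le_of_abs_le hx) (le_of_abs_le hx)) hcos n
  rwa [← exp_nat_mul, mul_neg] at hpow

/-- Bound for the conditional variance `σ²(θ) = 1 - A(θ)²/(1 - C(θ)²)` at `θ = z/√d`,
where `A(θ) = -√d cos^{d-1}(θ) sin(θ)` and `C(θ) = cos^d(θ)`: there are `0 < α < 1/2`
and `K > 0` such that for all `d ≥ 2` and `0 < z < √d·π/2`, the quantity is well
defined (`C² < 1`) and `0 ≤ 1 - σ² ≤ K exp(-2α z²)`. -/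
theorem kss_bound_sigma :
    ∃ α : ℝ, 0 < α ∧ α < 1 / 2 ∧ ∃ K : ℝ, 0 < K ∧
      ∀ d : ℕ, 2 ≤ d → ∀ z : ℝ, 0 < z → z < Real.sqrt d * π / 2 →
        Real.cos (z / Real.sqrt d) ^ d * Real.cos (z / Real.sqrt d) ^ d < 1 ∧
        (0 ≤ 1 - (1 -
            (Real.sqrt d * Real.cos (z / Real.sqrt d) ^ (d - 1)
                * Real.sin (z / Real.sqrt d)) ^ 2
              / (1 - (Real.cos (z / Real.sqrt d) ^ d) ^ 2)) ∧
          1 - (1 -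
            (Real.sqrt d * Real.cos (z / Real.sqrt d) ^ (d - 1)
                * Real.sin (z / Real.sqrt d)) ^ 2
              / (1 - (Real.cos (z / Real.sqrt d) ^ d) ^ 2))
            ≤ K * Real.exp (-2 * α * z ^ 2)) := by
  refine ⟨1 / (2 * π ^ 2), by positivity, ?_, 1, one_pos, fun d hd z hz hzlt => ?_⟩
  · rw [div_lt_div_iff₀ (by positivity) two_pos]
    nlinarith [pi_gt_three]
  have hd0 : (0 : ℝ) < d := by positivity
  have hd2 : (2 : ℝ) ≤ d := by exact_mod_cast hd
  have hsqrt : 0 < √(d : ℝ) := sqrt_pos.mpr hd0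
  set θ := z / √(d : ℝ) with hθ
  have hθ0 : 0 < θ := by positivity
  have hθlt : θ < π / 2 := by
    rw [hθ, div_lt_iff₀ hsqrt]
    linarith
  have hθsq : d * θ ^ 2 = z ^ 2 := by
    rw [hθ, div_pow, sq_sqrt hd0.le]
    field_simp
  have hcos0 : 0 < cos θ := cos_pos_of_mem_Ioo ⟨by linarith, hθlt⟩
  have hcos1 : cos θ < 1 := by
    simpa using cos_lt_cos_of_nonneg_of_le_pi_div_two le_rfl hθlt.le hθ0
  have hC : (cos θ ^ d) ^ 2 < 1 :=
    pow_lt_one₀ (by positivity) (pow_lt_one₀ hcos0.le hcos1 (by omega)) two_ne_zero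
  have hden : 0 < 1 - (cos θ ^ d) ^ 2 := by linarith
  rw [sub_sub_cancel]
  refine ⟨by rwa [← sq], by positivity, ?_⟩
  calc (√(d : ℝ) * cos θ ^ (d - 1) * sin θ) ^ 2 / (1 - (cos θ ^ d) ^ 2)
      ≤ cos θ ^ (d - 1) := by
        rw [div_le_iff₀ hden, mul_pow, mul_pow, sq_sqrt hd0.le, sin_sq]
        have h := mul_le_mul_of_nonneg_left
          (natCast_mul_pow_pred_mul_one_sub_sq_le d (pow_le_one₀ hcos0.le hcos1.le))
          (pow_nonneg hcos0.le (d - 1))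
        linarith
    _ ≤ exp (-((d - 1 : ℕ) * (2 / π ^ 2 * θ ^ 2))) :=
        cos_pow_le_exp_neg (by rw [abs_of_pos hθ0]; exact hθlt.le) _
    _ ≤ 1 * exp (-2 * (1 / (2 * π ^ 2)) * z ^ 2) := by
        rw [one_mul, exp_le_exp, ← hθsq, Nat.cast_sub (by omega), Nat.cast_one]
        have h : 0 ≤ (d - 2) * (θ ^ 2 / π ^ 2) := mul_nonneg (by linarith) (by positivity)
        have hdiff : -2 * (1 / (2 * π ^ 2)) * (d * θ ^ 2) - -((d - 1) * (2 / π ^ 2 * θ ^ 2)) =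
            (d - 2) * (θ ^ 2 / π ^ 2) := by
          field_simp
          ring
        linarith
end

section
/- There exist α with 0 < α < 1/2 and a constant K > 0 such that for every integer d ≥ 2 and every real z with 0 < z < √d·π/2, the denominator 1 − C(z/√d)² − A(z/√d)² is strictly positive and the quantity ρ(z/√d) = (B(z/√d)·(1 − C(z/√d)²) − A(z/√d)²·C(z/√d)) / (1 − C(z/√d)² − A(z/√d)²) satisfies |ρ(z/√d)| ≤ K · (1 + z²)² · exp(−2α z²). -/
open Real

/-- `A(θ) = -√d cos^{d-1}(θ) sin(θ)`. -/
noncomputable def kssA (d : ℕ) (θ : ℝ) : ℝ :=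
  -(Real.sqrt d * Real.cos θ ^ (d - 1) * Real.sin θ)

/-- `B(θ) = cos^d(θ) - (d-1) cos^{d-2}(θ) sin²(θ)`. -/
noncomputable def kssB (d : ℕ) (θ : ℝ) : ℝ :=
  Real.cos θ ^ d - (d - 1 : ℝ) * Real.cos θ ^ (d - 2) * Real.sin θ ^ 2

/-- `C(θ) = cos^d(θ)`. -/
noncomputable def kssC (d : ℕ) (θ : ℝ) : ℝ := Real.cos θ ^ d

/-- `ρ(θ) = (B(θ)(1-C(θ)²) - A(θ)² C(θ)) / (1 - C(θ)² - A(θ)²)`. -/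
noncomputable def kssRho (d : ℕ) (θ : ℝ) : ℝ :=
  (kssB d θ * (1 - kssC d θ ^ 2) - kssA d θ ^ 2 * kssC d θ)
    / (1 - kssC d θ ^ 2 - kssA d θ ^ 2)

/-- A truncated exponential-type bound, obtained by induction since the left-hand side is
antitone in `n`. -/
lemma one_sub_pow_mul_quadratic_le_two {p : ℝ} (h0 : 0 ≤ p) (h1 : p ≤ 1) (n : ℕ) :
    (1 - p) ^ n * (2 + 2 * n * p + n * (n + 1) * p ^ 2) ≤ 2 := by
  induction n with
  | zero => simp
  | succ n ih =>
    refine le_trans ?_ ih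
    rw [pow_succ, mul_assoc]
    refine mul_le_mul_of_nonneg_left ?_ (pow_nonneg (by linarith) n)
    have : 0 ≤ ((n : ℝ) + 1) * (n + 2) * p ^ 3 := by positivity
    push_cast
    linarith

/-- Strict Bernoulli inequality. -/
lemma one_sub_mul_lt_one_sub_pow {p : ℝ} (h0 : 0 < p) (h1 : p ≤ 1) (n : ℕ) :
    1 - (n + 2 : ℝ) * p < (1 - p) ^ (n + 2) := by
  induction n with
  | zero =>
    simp only [Nat.cast_zero, zero_add]
    linarith [sq_pos_of_pos h0]
  | succ n ih =>
    have hn : 0 ≤ (n : ℝ) * p ^ 2 := by positivity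
    have hle : (1 - (n + 2 : ℝ) * p) * (1 - p) ≤ (1 - p) ^ (n + 1 + 2) := by
      rw [show n + 1 + 2 = n + 2 + 1 by ring, pow_succ]
      exact mul_le_mul_of_nonneg_right ih.le (by linarith)
    push_cast
    linarith [sq_pos_of_pos h0]

/-- For `X` binomial with parameters `n + 2` and `p`, this reads
`E[(X - 1)⁺] ≤ (1 + E[X]) P(X ≥ 2)`. -/
lemma binomial_excess_le {p : ℝ} (h0 : 0 ≤ p) (h1 : p ≤ 1) (n : ℕ) :
    (n + 2 : ℝ) * p - 1 + (1 - p) ^ (n + 2) ≤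
      (1 + (n + 2 : ℝ) * p) * (1 - (1 - p) ^ (n + 2) - (n + 2) * (1 - p) ^ (n + 1) * p) := by
  have h := one_sub_pow_mul_quadratic_le_two h0 h1 (n + 1)
  rw [pow_succ (1 - p) (n + 1)]
  push_cast at h
  linarith

lemma kss_denominator_eq (n : ℕ) (θ : ℝ) :
    1 - kssC (n + 2) θ ^ 2 - kssA (n + 2) θ ^ 2 =
      1 - (1 - sin θ ^ 2) ^ (n + 2) - (n + 2) * (1 - sin θ ^ 2) ^ (n + 1) * sin θ ^ 2 := by
  have hs : √((n : ℝ) + 2) ^ 2 = n + 2 := sq_sqrt (by positivity)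
  simp only [kssC, kssA, ← cos_sq', Nat.cast_add, Nat.cast_ofNat,
    show n + 2 - 1 = n + 1 from rfl, neg_sq, mul_pow, hs, ← pow_mul, mul_comm 2]

lemma kss_numerator_eq (n : ℕ) (θ : ℝ) :
    kssB (n + 2) θ * (1 - kssC (n + 2) θ ^ 2) - kssA (n + 2) θ ^ 2 * kssC (n + 2) θ =
      -(cos θ ^ n * ((n + 2) * sin θ ^ 2 - 1 + (1 - sin θ ^ 2) ^ (n + 2))) := by
  have hs : √((n : ℝ) + 2) ^ 2 = n + 2 := sq_sqrt (by positivity)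
  simp only [kssC, kssA, kssB, Nat.add_sub_cancel, Nat.cast_add, Nat.cast_ofNat,
    show n + 2 - 1 = n + 1 from rfl, neg_sq, mul_pow, hs, ← cos_sq']
  rw [sin_sq]
  ring

lemma kss_denominator_pos (n : ℕ) {θ : ℝ} (h : sin θ ≠ 0) :
    0 < 1 - kssC (n + 2) θ ^ 2 - kssA (n + 2) θ ^ 2 := by
  have hp : 0 < sin θ ^ 2 := by positivity
  have h1 := sin_sq_le_one θ
  rw [kss_denominator_eq]
  refine pos_of_mul_pos_right (a := 1 + (n + 2 : ℝ) * sin θ ^ 2) ?_ (by positivity)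
  linarith [one_sub_mul_lt_one_sub_pow hp h1 n, binomial_excess_le hp.le h1 n]

lemma abs_kssRho_le (n : ℕ) {θ : ℝ} (h : sin θ ≠ 0) :
    |kssRho (n + 2) θ| ≤ |cos θ| ^ n * (1 + (n + 2) * sin θ ^ 2) := by
  have hp : 0 < sin θ ^ 2 := by positivity
  have h1 := sin_sq_le_one θ
  have hD := kss_denominator_pos n h
  have hN : 0 < (n + 2 : ℝ) * sin θ ^ 2 - 1 + (1 - sin θ ^ 2) ^ (n + 2) := by
    linarith [one_sub_mul_lt_one_sub_pow hp h1 n]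
  rw [kssRho, abs_div, abs_of_pos hD, div_le_iff₀ hD, kss_numerator_eq, kss_denominator_eq,
    abs_neg, abs_mul, abs_pow, abs_of_pos hN, mul_assoc]
  exact mul_le_mul_of_nonneg_left (binomial_excess_le hp.le h1 n) (by positivity)

lemma cos_le_exp_neg_sq_div_eight {θ : ℝ} (h : |θ| ≤ π) : cos θ ≤ exp (-(θ ^ 2 / 8)) := by
  have hπ : (1 : ℝ) / 8 ≤ 2 / π ^ 2 := by
    rw [div_le_div_iff₀ (by norm_num) (by positivity)]
    nlinarith [pi_pos, pi_le_four]
  have := mul_le_mul_of_nonneg_right hπ (sq_nonneg θ)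
  linarith [cos_le_one_sub_mul_cos_sq h, add_one_le_exp (-(θ ^ 2 / 8))]

/-- Bound for the conditional correlation `ρ` at `θ = z/√d`: there are `0 < α < 1/2`
and `K > 0` such that for all `d ≥ 2` and `0 < z < √d·π/2`, the denominator
`1 - C² - A²` is positive and `|ρ(z/√d)| ≤ K (1+z²)² exp(-2α z²)`. -/
theorem kss_bound_rho :
    ∃ α : ℝ, 0 < α ∧ α < 1 / 2 ∧ ∃ K : ℝ, 0 < K ∧
      ∀ d : ℕ, 2 ≤ d → ∀ z : ℝ, 0 < z → z < Real.sqrt d * π / 2 →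
        0 < 1 - kssC d (z / Real.sqrt d) ^ 2 - kssA d (z / Real.sqrt d) ^ 2 ∧
        |kssRho d (z / Real.sqrt d)| ≤ K * (1 + z ^ 2) ^ 2 * Real.exp (-2 * α * z ^ 2) := by
  refine ⟨1 / 16, by norm_num, by norm_num, exp 1, exp_pos 1, fun d hd z hz0 hz => ?_⟩
  obtain ⟨n, rfl⟩ := Nat.exists_eq_add_of_le' hd
  have hd0 : 0 < √((n + 2 : ℕ) : ℝ) := sqrt_pos.2 (by positivity)
  obtain ⟨θ, hθ⟩ : ∃ θ, θ = z / √((n + 2 : ℕ) : ℝ) := ⟨_, rfl⟩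
  have hθ0 : 0 < θ := hθ ▸ div_pos hz0 hd0
  have hθ1 : θ < π / 2 := by
    rw [hθ, div_lt_iff₀ hd0]
    linarith
  have hz2 : z ^ 2 = (n + 2) * θ ^ 2 := by
    rw [hθ, div_pow, sq_sqrt (by positivity)]
    push_cast
    field_simp
  have hsin : 0 < sin θ := sin_pos_of_pos_of_lt_pi hθ0 (by linarith)
  have hcos : 0 < cos θ := cos_pos_of_mem_Ioo ⟨by linarith, hθ1⟩
  rw [← hθ]
  refine ⟨kss_denominator_pos n hsin.ne', (abs_kssRho_le n hsin.ne').trans ?_⟩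
  have hpow : |cos θ| ^ n ≤ exp 1 * exp (-2 * (1 / 16) * z ^ 2) := by
    rw [abs_of_pos hcos, ← exp_add]
    calc cos θ ^ n ≤ exp (-(θ ^ 2 / 8)) ^ n :=
          pow_le_pow_left₀ hcos.le
            (cos_le_exp_neg_sq_div_eight (by rw [abs_of_pos hθ0]; linarith)) n
      _ = exp (n * -(θ ^ 2 / 8)) := (exp_nat_mul _ n).symm
      _ ≤ exp (1 + -2 * (1 / 16) * z ^ 2) := by
          have : θ ^ 2 ≤ 4 := by nlinarith [pi_le_four]
          rw [exp_le_exp, hz2]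
          linarith
  have hfactor : 1 + (n + 2) * sin θ ^ 2 ≤ (1 + z ^ 2) ^ 2 := by
    have : (n + 2) * sin θ ^ 2 ≤ z ^ 2 := by
      rw [hz2]
      gcongr
      exact sin_le hθ0.le
    nlinarith [sq_nonneg z, sq_nonneg (z ^ 2)]
  calc |cos θ| ^ n * (1 + (n + 2) * sin θ ^ 2)
      ≤ exp 1 * exp (-2 * (1 / 16) * z ^ 2) * (1 + z ^ 2) ^ 2 := by gcongr
    _ = exp 1 * (1 + z ^ 2) ^ 2 * exp (-2 * (1 / 16) * z ^ 2) := by ring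
end

section
/- For every integer m ≥ 1, the following three limits hold as the integer d → ∞: (i) d^{m/3} · ∫_0^{π/2} sin^{m−1}(θ) · cos^d(θ) dθ → 0; (ii) d^{m/3} · ∫_0^{π/2} sin^{m−1}(θ) · √d · cos^{d−1}(θ) · sin(θ) dθ → 0; (iii) d^{m/3} · ∫_0^{π/2} sin^{m−1}(θ) · |cos^d(θ) − (d−1)·cos^{d−2}(θ)·sin²(θ)| dθ → 0. -/
open Real Filter MeasureTheory

/-- A Gaussian upper bound for powers of the cosine on `[0, π/2]`. -/
lemma cos_pow_sub_le_exp {k d : ℕ} (hd : 2 * k ≤ d) {θ : ℝ} (h0 : 0 ≤ θ) (h1 : θ ≤ π / 2) :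
    Real.cos θ ^ (d - k) ≤ Real.exp (-((π ^ 2)⁻¹ * d) * θ ^ (2 : ℝ)) := by
  have hcos : 0 ≤ Real.cos θ := Real.cos_nonneg_of_mem_Icc ⟨by linarith [Real.pi_pos], h1⟩
  have hle : Real.cos θ ≤ Real.exp (-(2 / π ^ 2 * θ ^ 2)) :=
    (Real.cos_le_one_sub_mul_cos_sq (by
      rw [abs_of_nonneg h0]; linarith [Real.pi_pos])).trans (Real.one_sub_le_exp_neg _)
  calc Real.cos θ ^ (d - k) ≤ Real.exp (-(2 / π ^ 2 * θ ^ 2)) ^ (d - k) := by gcongr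
    _ = Real.exp ((d - k : ℕ) * -(2 / π ^ 2 * θ ^ 2)) := (Real.exp_nat_mul _ _).symm
    _ ≤ _ := by
      have hcast : (d : ℝ) ≤ 2 * ((d - k : ℕ) : ℝ) := by
        exact_mod_cast (by omega : d ≤ 2 * (d - k))
      rw [Real.rpow_two]
      apply Real.exp_le_exp.mpr
      have := mul_le_mul_of_nonneg_right hcast (by positivity : 0 ≤ (π ^ 2)⁻¹ * θ ^ 2)
      rw [div_eq_mul_inv]
      linarith

/-- The Wallis-type integral `∫ sin^p cos^(d-k)` decays at rate `d^(-(p+1)/2)`. -/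
lemma exists_integral_sin_pow_mul_cos_pow_sub_le (p k : ℕ) :
    ∃ C : ℝ, ∀ d : ℕ, 1 ≤ d → 2 * k ≤ d →
      ∫ θ in (0:ℝ)..(π / 2), Real.sin θ ^ p * Real.cos θ ^ (d - k) ≤
        C * (d : ℝ) ^ (-((p : ℝ) + 1) / 2) := by
  refine ⟨(π ^ 2)⁻¹ ^ (-((p : ℝ) + 1) / 2) * (1 / 2) * Real.Gamma (((p : ℝ) + 1) / 2),
    fun d hd hk => ?_⟩
  have hd0 : (0 : ℝ) < d := by exact_mod_cast hd
  have hpi : (0 : ℝ) ≤ π / 2 := by positivity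
  have hb : 0 < (π ^ 2)⁻¹ * (d : ℝ) := by positivity
  have hp : (-1 : ℝ) < p := by linarith [(Nat.cast_nonneg p : (0 : ℝ) ≤ p)]
  have hint : IntegrableOn
      (fun θ : ℝ => θ ^ (p : ℝ) * Real.exp (-((π ^ 2)⁻¹ * d) * θ ^ (2 : ℝ))) (Set.Ioi 0) :=
    integrableOn_rpow_mul_exp_neg_mul_rpow hp (by norm_num) hb
  have hsub : Set.Ioc 0 (π / 2) ⊆ Set.Ioi (0 : ℝ) := fun _ hx => hx.1
  calc ∫ θ in (0:ℝ)..(π / 2), Real.sin θ ^ p * Real.cos θ ^ (d - k)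
      = ∫ θ in Set.Ioc 0 (π / 2), Real.sin θ ^ p * Real.cos θ ^ (d - k) :=
        intervalIntegral.integral_of_le hpi
    _ ≤ ∫ θ in Set.Ioc 0 (π / 2),
          θ ^ (p : ℝ) * Real.exp (-((π ^ 2)⁻¹ * d) * θ ^ (2 : ℝ)) := by
        refine setIntegral_mono_on ?_ (hint.mono_set hsub) measurableSet_Ioc fun θ hθ => ?_
        · exact (Continuous.intervalIntegrable (by fun_prop) 0 (π / 2)).1
        · have hcos : 0 ≤ Real.cos θ :=
            Real.cos_nonneg_of_mem_Icc ⟨by linarith [hθ.1], hθ.2⟩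
          have hsin : 0 ≤ Real.sin θ :=
            Real.sin_nonneg_of_nonneg_of_le_pi hθ.1.le (by linarith [hθ.2])
          rw [Real.rpow_natCast]
          exact mul_le_mul (pow_le_pow_left₀ hsin (Real.sin_le hθ.1.le) p)
            (cos_pow_sub_le_exp hk hθ.1.le hθ.2) (by positivity) (pow_nonneg hθ.1.le p)
    _ ≤ ∫ θ in Set.Ioi (0 : ℝ),
          θ ^ (p : ℝ) * Real.exp (-((π ^ 2)⁻¹ * d) * θ ^ (2 : ℝ)) := by
        refine setIntegral_mono_set hint ?_ hsub.eventuallyLE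
        filter_upwards [ae_restrict_mem measurableSet_Ioi] with θ hθ
        have : (0 : ℝ) ≤ θ := le_of_lt hθ
        simp only [Pi.zero_apply]
        positivity
    _ = _ := by
        rw [integral_rpow_mul_exp_neg_mul_rpow (by norm_num) hp hb,
          Real.mul_rpow (by positivity) hd0.le]
        ring

lemma integral_sin_pow_mul_cos_pow_nonneg (p q : ℕ) :
    0 ≤ ∫ θ in (0:ℝ)..(π / 2), Real.sin θ ^ p * Real.cos θ ^ q := by
  refine intervalIntegral.integral_nonneg (by positivity) fun θ hθ => ?_
  have hcos : 0 ≤ Real.cos θ := Real.cos_nonneg_of_mem_Icc ⟨by linarith [hθ.1, Real.pi_pos], hθ.2⟩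
  have hsin : 0 ≤ Real.sin θ :=
    Real.sin_nonneg_of_nonneg_of_le_pi hθ.1 (by linarith [hθ.2, Real.pi_pos])
  positivity

lemma tendsto_rpow_mul_integral_sin_pow_mul_cos_pow_sub (p k : ℕ) {a : ℝ}
    (ha : a < ((p : ℝ) + 1) / 2) :
    Tendsto (fun d : ℕ => (d : ℝ) ^ a *
        ∫ θ in (0:ℝ)..(π / 2), Real.sin θ ^ p * Real.cos θ ^ (d - k))
      atTop (nhds 0) := by
  obtain ⟨C, hC⟩ := exists_integral_sin_pow_mul_cos_pow_sub_le p k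
  have hlim : Tendsto (fun d : ℕ => C * (d : ℝ) ^ (-(((p : ℝ) + 1) / 2 - a))) atTop (nhds 0) := by
    simpa using ((tendsto_rpow_neg_atTop (sub_pos.mpr ha)).comp
      tendsto_natCast_atTop_atTop).const_mul C
  refine squeeze_zero' (Eventually.of_forall fun d => ?_) ?_ hlim
  · exact mul_nonneg (by positivity) (integral_sin_pow_mul_cos_pow_nonneg _ _)
  · filter_upwards [eventually_ge_atTop 1, eventually_ge_atTop (2 * k)] with d hd hk
    have hd0 : (0 : ℝ) < d := by exact_mod_cast hd
    calc _ ≤ (d : ℝ) ^ a * (C * (d : ℝ) ^ (-((p : ℝ) + 1) / 2)) := by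
          gcongr
          exact hC d hd hk
      _ = C * ((d : ℝ) ^ a * (d : ℝ) ^ (-((p : ℝ) + 1) / 2)) := by ring
      _ = _ := by
          rw [← Real.rpow_add hd0]
          congr 2
          ring

/-- The contraction condition: for `k = 0, 1, 2`, the quantity
`d^{m/3} ∫_0^{π/2} sin^{m-1}(θ) |r̄^{(k)}(cos θ)| dθ` tends to `0` as `d → ∞`, where
`r̄(cos θ) = cos^d θ` is the normalized KSS covariance and the first and second
normalized derivatives are `√d cos^{d-1}(θ) sin(θ)` and
`cos^d(θ) - (d-1) cos^{d-2}(θ) sin²(θ)`. -/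
theorem kss_contraction_condition (m : ℕ) (hm : 1 ≤ m) :
    Tendsto (fun d : ℕ => (d : ℝ) ^ ((m : ℝ) / 3) *
        ∫ θ in (0:ℝ)..(π / 2), Real.sin θ ^ (m - 1) * Real.cos θ ^ d)
      atTop (nhds 0) ∧
    Tendsto (fun d : ℕ => (d : ℝ) ^ ((m : ℝ) / 3) *
        ∫ θ in (0:ℝ)..(π / 2), Real.sin θ ^ (m - 1) *
          (Real.sqrt d * Real.cos θ ^ (d - 1) * Real.sin θ))
      atTop (nhds 0) ∧
    Tendsto (fun d : ℕ => (d : ℝ) ^ ((m : ℝ) / 3) *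
        ∫ θ in (0:ℝ)..(π / 2), Real.sin θ ^ (m - 1) *
          |Real.cos θ ^ d - (d - 1 : ℝ) * Real.cos θ ^ (d - 2) * Real.sin θ ^ 2|)
      atTop (nhds 0) := by
  obtain ⟨n, rfl⟩ : ∃ n, m = n + 1 := ⟨m - 1, by omega⟩
  have hn : (0 : ℝ) ≤ n := n.cast_nonneg
  simp only [Nat.add_sub_cancel, Nat.cast_add, Nat.cast_one]
  have hzeroth := tendsto_rpow_mul_integral_sin_pow_mul_cos_pow_sub n 0
    (a := ((n : ℝ) + 1) / 3) (by linarith)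
  have hfirst := tendsto_rpow_mul_integral_sin_pow_mul_cos_pow_sub (n + 1) 1
    (a := ((n : ℝ) + 1) / 3 + 1 / 2) (by push_cast; linarith)
  have hsecond := tendsto_rpow_mul_integral_sin_pow_mul_cos_pow_sub (n + 2) 2
    (a := ((n : ℝ) + 1) / 3 + 1) (by push_cast; linarith)
  simp only [Nat.sub_zero] at hzeroth
  refine ⟨hzeroth, hfirst.congr' ?_, ?_⟩
  · filter_upwards [eventually_ge_atTop 1] with d hd
    have hd0 : (0 : ℝ) < d := by exact_mod_cast hd
    rw [Real.rpow_add hd0, ← Real.sqrt_eq_rpow, mul_assoc,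
      ← intervalIntegral.integral_const_mul]
    congr 2
    ext θ
    ring
  · have hsum := hzeroth.add hsecond
    rw [add_zero] at hsum
    refine squeeze_zero' (Eventually.of_forall fun d => ?_) ?_ hsum
    · refine mul_nonneg (by positivity)
        (intervalIntegral.integral_nonneg (by positivity) fun θ hθ => ?_)
      have hsin : 0 ≤ Real.sin θ :=
        Real.sin_nonneg_of_nonneg_of_le_pi hθ.1 (by linarith [hθ.2, Real.pi_pos])
      positivity
    · filter_upwards [eventually_ge_atTop 1] with d hd
      have hd1 : (1 : ℝ) ≤ d := by exact_mod_cast hd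
      rw [Real.rpow_add_one (by positivity), mul_assoc, ← mul_add,
        ← intervalIntegral.integral_const_mul (d : ℝ), ← intervalIntegral.integral_add
          (Continuous.intervalIntegrable (by fun_prop) _ _)
          (Continuous.intervalIntegrable (by fun_prop) _ _)]
      gcongr
      refine intervalIntegral.integral_mono_on (by positivity)
        (Continuous.intervalIntegrable (by fun_prop) _ _)
        (Continuous.intervalIntegrable (by fun_prop) _ _) fun θ hθ => ?_
      have hcos : 0 ≤ Real.cos θ :=
        Real.cos_nonneg_of_mem_Icc ⟨by linarith [hθ.1, Real.pi_pos], hθ.2⟩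
      have hsin : 0 ≤ Real.sin θ :=
        Real.sin_nonneg_of_nonneg_of_le_pi hθ.1 (by linarith [hθ.2, Real.pi_pos])
      have hprod : 0 ≤ Real.cos θ ^ (d - 2) * Real.sin θ ^ 2 := by positivity
      have hpow : 0 ≤ Real.cos θ ^ d := by positivity
      calc _ ≤ Real.sin θ ^ n *
            (Real.cos θ ^ d + d * (Real.cos θ ^ (d - 2) * Real.sin θ ^ 2)) := by
            gcongr
            rw [abs_le]
            constructor <;> nlinarith
        _ = _ := by ring
end

section
/- Let m ≥ 1 and let u, v ∈ ℝ^m be fixed. For every integer d > max(‖u‖², ‖v‖²) define Γ_d(u,v) = (⟨u,v⟩/d + √(1 − ‖u‖²/d) · √(1 − ‖v‖²/d))^d. Then lim_{d→∞} Γ_d(u,v) = exp(−‖u − v‖²/2). -/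
open Real Filter

/-- First-order expansion at `0` of `c t + √(1 - a t) √(1 - b t)`. -/
lemma hasDerivAt_mul_add_sqrt_mul_sqrt (a b c : ℝ) :
    HasDerivAt (fun t : ℝ => c * t + √(1 - a * t) * √(1 - b * t)) (c - (a + b) / 2) 0 := by
  have h (r : ℝ) : HasDerivAt (fun t : ℝ => √(1 - r * t)) (-r / 2) 0 := by
    have := (((hasDerivAt_id (0 : ℝ)).const_mul r).const_sub 1).sqrt (by simp)
    simpa using this
  refine (((hasDerivAt_id (0 : ℝ)).const_mul c).add ((h a).mul (h b))).congr_deriv ?_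
  simp only [mul_zero, sub_zero, Real.sqrt_one]
  ring

/-- A function with value `1` and derivative `l` at `0` satisfies `f (1 / n) ^ n → exp l`. -/
lemma HasDerivAt.tendsto_inv_natCast_pow_exp {f : ℝ → ℝ} {l : ℝ} (hf : HasDerivAt f l 0)
    (h0 : f 0 = 1) :
    Tendsto (fun n : ℕ => f (n : ℝ)⁻¹ ^ n) atTop (nhds (Real.exp l)) := by
  have hinv : Tendsto (fun n : ℕ => (n : ℝ)⁻¹) atTop (nhdsWithin 0 {0}ᶜ) := by
    refine tendsto_nhdsWithin_iff.2 ⟨tendsto_inv_atTop_nhds_zero_nat, ?_⟩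
    filter_upwards [eventually_ne_atTop 0] with n hn
    simpa using hn
  have hg : Tendsto (fun n : ℕ => (n : ℝ) * (f (n : ℝ)⁻¹ - 1)) atTop (nhds l) := by
    simpa [Function.comp_def, h0] using (hasDerivAt_iff_tendsto_slope_zero.1 hf).comp hinv
  simpa using Real.tendsto_one_add_pow_exp_of_tendsto hg

/-- Convergence of the rescaled KSS covariance to the covariance of the local limit
field: for fixed `u, v ∈ ℝ^m`,
`(⟨u,v⟩/d + √(1-‖u‖²/d) √(1-‖v‖²/d))^d → exp(-‖u-v‖²/2)` as `d → ∞`. -/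
theorem kss_local_covariance_limit (m : ℕ) (hm : 1 ≤ m)
    (u v : EuclideanSpace ℝ (Fin m)) :
    Tendsto (fun d : ℕ =>
        ((∑ i, u i * v i) / d
            + Real.sqrt (1 - ‖u‖ ^ 2 / d) * Real.sqrt (1 - ‖v‖ ^ 2 / d)) ^ d)
      atTop (nhds (Real.exp (-‖u - v‖ ^ 2 / 2))) := by
  have hexp : -‖u - v‖ ^ 2 / 2 = (∑ i, u i * v i) - (‖u‖ ^ 2 + ‖v‖ ^ 2) / 2 := by
    have hinner : inner ℝ u v = ∑ i, u i * v i := by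
      simp [PiLp.inner_apply, mul_comm]
    rw [norm_sub_sq_real, hinner]
    ring
  rw [hexp]
  simpa only [← div_eq_mul_inv] using
    (hasDerivAt_mul_add_sqrt_mul_sqrt (‖u‖ ^ 2) (‖v‖ ^ 2)
      (∑ i, u i * v i)).tendsto_inv_natCast_pow_exp (by simp)
end

section
/- Let m ≥ 1 and let Γ : ℝ^m → ℝ be defined by Γ(u) = exp(−‖u‖²/2). Then for every δ > 0 the integral ∫_{B(0,δ)} ‖D²Γ(u) − D²Γ(0)‖ / ‖u‖^m du is finite, where D²Γ denotes the second (Fréchet) derivative of Γ and B(0,δ) is the open Euclidean ball of radius δ in ℝ^m. -/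
open Real MeasureTheory

/-- A `C¹` map on a finite-dimensional space grows at most linearly from its value at the origin,
on every ball centred at the origin. -/
theorem ContDiff.exists_norm_sub_zero_le_mul_norm {E F : Type*} [NormedAddCommGroup E]
    [NormedSpace ℝ E] [FiniteDimensional ℝ E] [NormedAddCommGroup F] [NormedSpace ℝ F]
    {g : E → F} (hg : ContDiff ℝ 1 g) (δ : ℝ) :
    ∃ C : ℝ, ∀ u ∈ Metric.ball (0 : E) δ, ‖g u - g 0‖ ≤ C * ‖u‖ := by
  have : ProperSpace E := FiniteDimensional.proper_real E
  obtain ⟨C, hC⟩ := (isCompact_closedBall (0 : E) δ).exists_bound_of_continuousOn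
    (hg.continuous_fderiv one_ne_zero).continuousOn
  refine ⟨C, fun u hu => ?_⟩
  have h0 : (0 : E) ∈ Metric.ball (0 : E) δ := Metric.mem_ball_self (Metric.pos_of_mem_ball hu)
  simpa using (convex_ball (0 : E) δ).norm_image_sub_le_of_norm_fderiv_le
    (fun x _ => (hg.differentiable one_ne_zero) x)
    (fun x hx => hC x (Metric.ball_subset_closedBall hx)) h0 hu

/-- For a `C¹` map `g` on a space of dimension `d ≥ 1`, the function
`u ↦ ‖g u - g 0‖ / ‖u‖ ^ d` is integrable on every ball centred at the origin. -/
theorem ContDiff.integrableOn_ball_norm_sub_div_norm_pow {E F : Type*} [NormedAddCommGroup E]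
    [NormedSpace ℝ E] [FiniteDimensional ℝ E] [MeasurableSpace E] [BorelSpace E]
    [NormedAddCommGroup F] [NormedSpace ℝ F] {μ : Measure E} [μ.IsAddHaarMeasure]
    {g : E → F} (hg : ContDiff ℝ 1 g) (hd : 1 ≤ Module.finrank ℝ E) (δ : ℝ) :
    IntegrableOn (fun u => ‖g u - g 0‖ / ‖u‖ ^ Module.finrank ℝ E) (Metric.ball 0 δ) μ := by
  obtain ⟨C, hC⟩ := hg.exists_norm_sub_zero_le_mul_norm δ
  refine integrableOn_ball_of_norm_le_rpow (C := C) (α := (Module.finrank ℝ E : ℝ) - 1) hd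
    (by linarith) ?_ ?_
  · have : Nontrivial E := Module.nontrivial_of_finrank_pos (R := ℝ) hd
    filter_upwards [ae_restrict_mem Metric.isOpen_ball.measurableSet,
      ae_restrict_of_ae (Measure.ae_ne μ 0)] with u hu hu0
    have hpos : 0 < ‖u‖ := norm_pos_iff.2 hu0
    rw [neg_sub, Real.rpow_sub hpos, Real.rpow_one, Real.rpow_natCast, ← mul_div_assoc,
      Real.norm_of_nonneg (by positivity)]
    gcongr
    exact hC u hu
  · have := hg.continuous.sub (continuous_const (y := g 0))
    exact (this.norm.measurable.div (measurable_norm.pow_const _)).aestronglyMeasurable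

/-- The Estrade–Fournier condition for the local limit covariance
`Γ(u) = exp(-‖u‖²/2)`: for every `δ > 0`, the function
`u ↦ ‖D²Γ(u) - D²Γ(0)‖ / ‖u‖^m` is integrable on the ball `B(0,δ) ⊂ ℝ^m`. -/
theorem estrade_fournier_condition (m : ℕ) (hm : 1 ≤ m) (δ : ℝ) (hδ : 0 < δ) :
    IntegrableOn
      (fun u : EuclideanSpace ℝ (Fin m) =>
        ‖iteratedFDeriv ℝ 2 (fun w : EuclideanSpace ℝ (Fin m) =>
              Real.exp (-‖w‖ ^ 2 / 2)) u
            - iteratedFDeriv ℝ 2 (fun w : EuclideanSpace ℝ (Fin m) =>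
              Real.exp (-‖w‖ ^ 2 / 2)) 0‖ / ‖u‖ ^ m)
      (Metric.ball (0 : EuclideanSpace ℝ (Fin m)) δ) volume := by
  have hΓ : ContDiff ℝ 3 (fun w : EuclideanSpace ℝ (Fin m) => Real.exp (-‖w‖ ^ 2 / 2)) :=
    Real.contDiff_exp.comp ((contDiff_norm_sq ℝ).neg.div_const 2)
  have hD : ContDiff ℝ 1 (iteratedFDeriv ℝ 2
      (fun w : EuclideanSpace ℝ (Fin m) => Real.exp (-‖w‖ ^ 2 / 2))) :=
    hΓ.iteratedFDeriv_right (by norm_num)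
  simpa only [finrank_euclideanSpace_fin] using
    hD.integrableOn_ball_norm_sub_div_norm_pow (μ := volume) (by simpa using hm) δ
end

section
/- For every integer m ≥ 1 and every real α with 0 < α < 1/m there exists a constant C > 0 such that for all sufficiently large integers d there exist pairwise disjoint Borel subsets R_1,…,R_k of the unit sphere S^m ⊂ ℝ^{m+1} with the following properties: (i) k ≤ C · d^{m/2}; (ii) each R_j has diameter at most C/√d (for the geodesic distance on S^m); (iii) for each j, the number of indices ℓ such that the geodesic distance between R_j and R_ℓ is less than 1/√d is at most C; (iv) the surface measure of the exceptional set S^m \ (R_1 ∪ … ∪ R_k) is at most C · d^{−α/2}. -/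
open Real MeasureTheory

/-- The geodesic distance on the unit sphere: `dist(s,t) = arccos ⟨s,t⟩`. -/
noncomputable def geoDist {n : ℕ} (s t : EuclideanSpace ℝ (Fin n)) : ℝ :=
  Real.arccos (∑ i, s i * t i)

/-- Volume packing: disjoint balls of radius `r` inside a spherical shell. -/
theorem card_mul_pow_le_of_ball_subset_shell {n : ℕ} {T : Finset (EuclideanSpace ℝ (Fin (n + 1)))}
    {c : EuclideanSpace ℝ (Fin (n + 1))} {r a b : ℝ} (hr : 0 ≤ r) (ha : 0 ≤ a) (hab : a ≤ b)
    (hsep : ∀ p ∈ T, ∀ q ∈ T, p ≠ q → 2 * r ≤ dist p q)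
    (hsub : ∀ p ∈ T, Metric.ball p r ⊆ Metric.ball c b \ Metric.ball c a) :
    (T.card : ℝ) * r ^ (n + 1) ≤ b ^ (n + 1) - a ^ (n + 1) := by
  set μ : Measure (EuclideanSpace ℝ (Fin (n + 1))) := volume
  have hvol : ∀ (x : EuclideanSpace ℝ (Fin (n + 1))) {s : ℝ}, 0 ≤ s →
      μ.real (Metric.ball x s) = s ^ (n + 1) * μ.real (Metric.ball 0 1) := fun x s hs => by
    simp [measureReal_def, Measure.addHaar_ball μ x hs, ENNReal.toReal_ofReal (pow_nonneg hs _)]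
  have hunit : 0 < μ.real (Metric.ball (0 : EuclideanSpace ℝ (Fin (n + 1))) 1) :=
    ENNReal.toReal_pos (Metric.measure_ball_pos μ _ one_pos).ne' measure_ball_lt_top.ne
  have hunion : μ.real (⋃ p ∈ T, Metric.ball p r) = ∑ p ∈ T, μ.real (Metric.ball p r) :=
    measureReal_biUnion_finset
      (fun p hp q hq hpq => Metric.ball_disjoint_ball (by linarith [hsep p hp q hq hpq]))
      (fun _ _ => measurableSet_ball) (fun _ _ => measure_ball_lt_top.ne)
  have hdiff : μ.real (Metric.ball c b \ Metric.ball c a) =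
      μ.real (Metric.ball c b) - μ.real (Metric.ball c a) :=
    measureReal_sdiff (Metric.ball_subset_ball hab) measurableSet_ball
      measure_ball_lt_top.ne
  have hle : μ.real (⋃ p ∈ T, Metric.ball p r) ≤ μ.real (Metric.ball c b \ Metric.ball c a) :=
    measureReal_mono (Set.iUnion₂_subset hsub)
      ((measure_mono Set.sdiff_subset).trans_lt measure_ball_lt_top).ne
  rw [hunion, hdiff, Finset.sum_congr rfl fun p _ => hvol p hr, hvol c (ha.trans hab), hvol c ha,
    Finset.sum_const, nsmul_eq_mul, ← mul_assoc, ← sub_mul] at hle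
  exact le_of_mul_le_mul_right hle hunit

theorem pow_sub_pow_le_mul_sub {a b : ℝ} (ha : 0 ≤ a) (hab : a ≤ b) (n : ℕ) :
    b ^ (n + 1) - a ^ (n + 1) ≤ (n + 1) * b ^ n * (b - a) := by
  induction n with
  | zero => simp
  | succ n ih =>
    have hb : 0 ≤ b := ha.trans hab
    have hpow : a ^ (n + 1) ≤ b ^ (n + 1) := pow_le_pow_left₀ ha hab _
    have h₁ := mul_le_mul_of_nonneg_left ih hb
    have h₂ := mul_le_mul_of_nonneg_right hpow (sub_nonneg.2 hab)
    push_cast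
    ring_nf at h₁ h₂ ⊢
    linarith

section SeparatedSubsetsOfSphere

variable {m : ℕ} {T : Finset (EuclideanSpace ℝ (Fin (m + 1)))} {ε : ℝ}

theorem card_le_of_separated_of_subset_sphere (hε : 0 < ε) (hε1 : ε ≤ 1)
    (hsep : ∀ p ∈ T, ∀ q ∈ T, p ≠ q → ε ≤ dist p q)
    (hT : ∀ p ∈ T, p ∈ Metric.sphere (0 : EuclideanSpace ℝ (Fin (m + 1))) 1) :
    (T.card : ℝ) ≤ (m + 1) * 2 ^ (2 * m + 1) * (1 / ε) ^ m := by
  have hpack := card_mul_pow_le_of_ball_subset_shell (T := T) (c := 0) (r := ε / 2)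
    (a := 1 - ε / 2) (b := 1 + ε / 2) (by positivity) (by linarith) (by linarith)
    (fun p hp q hq hpq => by linarith [hsep p hp q hq hpq])
    (fun p hp x hx => by
      have hp1 := hT p hp
      rw [Metric.mem_sphere] at hp1
      rw [Metric.mem_ball] at hx
      simp only [Set.mem_sdiff, Metric.mem_ball, not_lt]
      constructor
      · linarith [dist_triangle x p 0]
      · linarith [dist_triangle p x 0, dist_comm x p])
  have hshell := pow_sub_pow_le_mul_sub (a := 1 - ε / 2) (b := 1 + ε / 2)
    (by linarith) (by linarith) m
  have hpow : (1 + ε / 2) ^ m ≤ (2 : ℝ) ^ m := pow_le_pow_left₀ (by positivity) (by linarith) _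
  have hmain : (T.card : ℝ) * (ε / 2) ^ (m + 1) ≤ (m + 1) * 2 ^ m * ε := by
    calc (T.card : ℝ) * (ε / 2) ^ (m + 1)
        ≤ (m + 1) * (1 + ε / 2) ^ m * (1 + ε / 2 - (1 - ε / 2)) := hpack.trans hshell
      _ = (m + 1) * (1 + ε / 2) ^ m * ε := by ring
      _ ≤ (m + 1) * 2 ^ m * ε := by gcongr
  have hpos : 0 < (ε / 2) ^ (m + 1) := by positivity
  refine le_of_mul_le_mul_right (hmain.trans_eq ?_) hpos
  have hone : (1 / ε) ^ m * ε ^ m = 1 := by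
    rw [← mul_pow, one_div_mul_cancel hε.ne', one_pow]
  have htwo : (2 : ℝ) ^ (m + 1) ≠ 0 := by positivity
  calc (m + 1) * 2 ^ m * ε = (m + 1) * 2 ^ m * ε * ((1 / ε) ^ m * ε ^ m) := by rw [hone, mul_one]
    _ = _ := by
      rw [div_pow ε]
      field_simp
      ring

theorem card_filter_dist_lt_le_of_separated (hε : 0 < ε)
    (hsep : ∀ p ∈ T, ∀ q ∈ T, p ≠ q → ε ≤ dist p q) (c : EuclideanSpace ℝ (Fin (m + 1))) :
    ((T.filter fun p => dist p c < 3 * ε).card : ℝ) ≤ 7 ^ (m + 1) := by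
  have hpack := card_mul_pow_le_of_ball_subset_shell (T := T.filter fun p => dist p c < 3 * ε)
    (c := c) (r := ε / 2) (a := 0) (b := 7 * (ε / 2)) (by positivity) le_rfl (by positivity)
    (fun p hp q hq hpq => by
      linarith [hsep p (Finset.mem_filter.1 hp).1 q (Finset.mem_filter.1 hq).1 hpq])
    (fun p hp x hx => by
      have hpc := (Finset.mem_filter.1 hp).2
      rw [Metric.mem_ball] at hx
      simp only [Metric.ball_zero, Set.sdiff_empty, Metric.mem_ball]
      linarith [dist_triangle x p c])
  rw [zero_pow (by omega), sub_zero, mul_pow] at hpack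
  exact le_of_mul_le_mul_right hpack (by positivity)

/-- A maximal `ε`-separated subset of the unit sphere. -/
theorem exists_separated_cover_sphere (m : ℕ) (hε : 0 < ε) (hε1 : ε ≤ 1) :
    ∃ T : Finset (EuclideanSpace ℝ (Fin (m + 1))),
      (∀ p ∈ T, p ∈ Metric.sphere (0 : EuclideanSpace ℝ (Fin (m + 1))) 1) ∧
      (∀ p ∈ T, ∀ q ∈ T, p ≠ q → ε ≤ dist p q) ∧
      ∀ x ∈ Metric.sphere (0 : EuclideanSpace ℝ (Fin (m + 1))) 1, ∃ p ∈ T, dist x p < ε := by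
  classical
  let P : Set (Finset (EuclideanSpace ℝ (Fin (m + 1)))) := {T |
    (∀ p ∈ T, p ∈ Metric.sphere (0 : EuclideanSpace ℝ (Fin (m + 1))) 1) ∧
      ∀ p ∈ T, ∀ q ∈ T, p ≠ q → ε ≤ dist p q}
  have hbdd : BddAbove (Finset.card '' P) := by
    refine ⟨⌊((m : ℝ) + 1) * 2 ^ (2 * m + 1) * (1 / ε) ^ m⌋₊, ?_⟩
    rintro _ ⟨T, hT, rfl⟩
    exact Nat.le_floor (card_le_of_separated_of_subset_sphere hε hε1 hT.2 hT.1)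
  obtain ⟨T, hT, hcard⟩ := Nat.sSup_mem (⟨_, ∅, by simp [P], rfl⟩ : (Finset.card '' P).Nonempty) hbdd
  refine ⟨T, hT.1, hT.2, fun x hx => ?_⟩
  by_contra! hfar
  have hxT : x ∉ T := fun h => by simpa using hε.trans_le (hfar x h)
  have hins : insert x T ∈ P := by
    refine ⟨?_, ?_⟩
    · simpa [Finset.forall_mem_insert] using ⟨by simpa using hx, by simpa using hT.1⟩
    · intro p hp q hq hpq
      rcases Finset.mem_insert.1 hp with rfl | hpT <;> rcases Finset.mem_insert.1 hq with rfl | hqT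
      · exact absurd rfl hpq
      · exact hfar q hqT
      · rw [dist_comm]; exact hfar p hpT
      · exact hT.2 p hpT q hqT hpq
  have hle := le_csSup hbdd (Set.mem_image_of_mem _ hins)
  rw [← hcard, Finset.card_insert_of_notMem hxT] at hle
  omega

end SeparatedSubsetsOfSphere

section ChordVersusArc

variable {n : ℕ} {s t : EuclideanSpace ℝ (Fin n)}

theorem dist_sq_eq_two_sub_two_cos_geoDist (hs : s ∈ Metric.sphere 0 1)
    (ht : t ∈ Metric.sphere 0 1) : dist s t ^ 2 = 2 - 2 * Real.cos (geoDist s t) := by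
  rw [mem_sphere_zero_iff_norm] at hs ht
  have hinner : ∑ i, s i * t i = inner ℝ s t := by
    simp [PiLp.inner_apply, mul_comm]
  have habs : |inner ℝ s t| ≤ 1 := by simpa [hs, ht] using abs_real_inner_le_norm s t
  rw [geoDist, hinner, Real.cos_arccos (abs_le.1 habs).1 (abs_le.1 habs).2, dist_eq_norm,
    norm_sub_sq_real, hs, ht]
  ring

theorem dist_le_geoDist (hs : s ∈ Metric.sphere 0 1) (ht : t ∈ Metric.sphere 0 1) :
    dist s t ≤ geoDist s t := by
  have hsq := dist_sq_eq_two_sub_two_cos_geoDist hs ht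
  have hcos := Real.one_sub_sq_div_two_le_cos (x := geoDist s t)
  exact le_of_sq_le_sq (by linarith) (Real.arccos_nonneg _)

theorem geoDist_le_two_mul_dist (hs : s ∈ Metric.sphere 0 1) (ht : t ∈ Metric.sphere 0 1) :
    geoDist s t ≤ 2 * dist s t := by
  have hsq := dist_sq_eq_two_sub_two_cos_geoDist hs ht
  have h₀ : 0 ≤ geoDist s t := Real.arccos_nonneg _
  have hcos := Real.cos_le_one_sub_mul_cos_sq (x := geoDist s t)
    ((abs_of_nonneg h₀).trans_le (Real.arccos_le_pi _))
  have hpi : (1 : ℝ) / 8 ≤ 2 / π ^ 2 := by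
    rw [div_le_div_iff₀ (by norm_num) (by positivity)]
    nlinarith [Real.pi_le_four, Real.pi_pos]
  have hmul := mul_le_mul_of_nonneg_right hpi (sq_nonneg (geoDist s t))
  exact le_of_sq_le_sq (by nlinarith) (by positivity)

end ChordVersusArc

/-- The asymptotic partition of the sphere: for every `m ≥ 1` and `0 < α < 1/m` there
is a constant `C > 0` such that for all large `d` there are pairwise disjoint Borel
subsets `R_1,…,R_k` of `S^m` with: (i) `k ≤ C d^{m/2}`; (ii) each `R_j` has geodesic
diameter at most `C/√d`; (iii) each `R_j` is at geodesic distance `< 1/√d` of at most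
`C` of the sets `R_ℓ`; (iv) the surface measure of the exceptional set
`S^m \ ⋃ R_j` is at most `C d^{-α/2}`. -/
theorem sphere_partition (m : ℕ) (hm : 1 ≤ m) (α : ℝ) (hα0 : 0 < α)
    (hα1 : α < 1 / m) :
    ∃ C : ℝ, 0 < C ∧ ∃ D : ℕ, ∀ d : ℕ, D ≤ d →
      ∃ (k : ℕ) (R : Fin k → Set (EuclideanSpace ℝ (Fin (m + 1)))),
        (∀ j, R j ⊆ Metric.sphere (0 : EuclideanSpace ℝ (Fin (m + 1))) 1) ∧
        (∀ j, MeasurableSet (R j)) ∧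
        Pairwise (fun i j => Disjoint (R i) (R j)) ∧
        (k : ℝ) ≤ C * (d : ℝ) ^ ((m : ℝ) / 2) ∧
        (∀ j, ∀ s ∈ R j, ∀ t ∈ R j, geoDist s t ≤ C / Real.sqrt d) ∧
        (∀ j, (Set.ncard {ℓ : Fin k |
            ∃ s ∈ R j, ∃ t ∈ R ℓ, geoDist s t < 1 / Real.sqrt d} : ℝ) ≤ C) ∧
        μH[(m : ℝ)] (Metric.sphere (0 : EuclideanSpace ℝ (Fin (m + 1))) 1 \ ⋃ j, R j)
          ≤ ENNReal.ofReal (C * (d : ℝ) ^ (-(α / 2))) := by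
  have hC : (0 : ℝ) < (m + 1) * 2 ^ (2 * m + 1) + 7 ^ (m + 1) + 4 := by positivity
  refine ⟨(m + 1) * 2 ^ (2 * m + 1) + 7 ^ (m + 1) + 4, hC, 1, fun d hd => ?_⟩
  have hd1 : (1 : ℝ) ≤ d := by exact_mod_cast hd
  have hsqrt : 1 ≤ √(d : ℝ) := Real.one_le_sqrt.2 hd1
  set ε : ℝ := 1 / √(d : ℝ) with hε_def
  have hε : 0 < ε := by positivity
  have hε1 : ε ≤ 1 := (div_le_one (by positivity)).2 hsqrt
  obtain ⟨T, hTS, hsep, hcover⟩ := exists_separated_cover_sphere m hε hε1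
  let p : Fin T.card → EuclideanSpace ℝ (Fin (m + 1)) := fun j => T.equivFin.symm j
  have hpT : ∀ j, p j ∈ T := fun j => (T.equivFin.symm j).2
  have hpinj : Function.Injective p := Subtype.val_injective.comp T.equivFin.symm.injective
  let R : Fin T.card → Set (EuclideanSpace ℝ (Fin (m + 1))) := fun j =>
    (Metric.sphere 0 1 ∩ Metric.ball (p j) ε) \ ⋃ i < j, Metric.ball (p i) ε
  have hR : ∀ {j x}, x ∈ R j → x ∈ Metric.sphere 0 1 ∧ dist x (p j) < ε := fun hx => hx.1
  refine ⟨T.card, R, fun j x hx => (hR hx).1, fun j => ?_, ?_, ?_, fun j s hs t ht => ?_,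
    fun j => ?_, ?_⟩
  · exact (Metric.isClosed_sphere.measurableSet.inter measurableSet_ball).diff
      (MeasurableSet.iUnion fun i => MeasurableSet.iUnion fun _ => measurableSet_ball)
  · have hlt : ∀ i j, i < j → Disjoint (R i) (R j) := fun i j hij =>
      Set.disjoint_left.2 fun x hxi hxj => hxj.2 (Set.mem_biUnion hij hxi.1.2)
    intro i j hij
    rcases lt_or_gt_of_ne hij with h | h
    · exact hlt i j h
    · exact (hlt j i h).symm
  · have hpow : (1 / ε) ^ m = (d : ℝ) ^ ((m : ℝ) / 2) := by
      rw [hε_def, one_div_one_div, Real.sqrt_eq_rpow, ← Real.rpow_natCast,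
        ← Real.rpow_mul (by positivity)]
      congr 1
      ring
    rw [← hpow]
    refine (card_le_of_separated_of_subset_sphere hε hε1 hsep hTS).trans ?_
    gcongr
    linarith [pow_pos (by norm_num : (0 : ℝ) < 7) (m + 1)]
  · have hgeo := geoDist_le_two_mul_dist (hR hs).1 (hR ht).1
    have hdist := dist_triangle_right s t (p j)
    calc geoDist s t ≤ 4 * ε := by linarith [(hR hs).2, (hR ht).2]
      _ ≤ ((m + 1) * 2 ^ (2 * m + 1) + 7 ^ (m + 1) + 4) * ε := by
        gcongr
        linarith [show (0 : ℝ) ≤ (m + 1) * 2 ^ (2 * m + 1) + 7 ^ (m + 1) by positivity]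
      _ = _ := by rw [hε_def, mul_one_div]
  · have hncard : Set.ncard {ℓ | ∃ s ∈ R j, ∃ t ∈ R ℓ, geoDist s t < ε} ≤
        (T.filter fun q => dist q (p j) < 3 * ε).card := by
      rw [← Set.ncard_coe_finset (T.filter _)]
      refine Set.ncard_le_ncard_of_injOn p ?_ hpinj.injOn (Finset.finite_toSet _)
      rintro ℓ ⟨s, hs, t, ht, hst⟩
      have hchord := dist_le_geoDist (hR hs).1 (hR ht).1
      simp only [Finset.coe_filter, Set.mem_ofPred_eq]
      refine ⟨hpT ℓ, ?_⟩
      linarith [dist_triangle4 (p ℓ) t s (p j), dist_comm s t, dist_comm t (p ℓ), (hR hs).2,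
        (hR ht).2]
    calc (Set.ncard {ℓ | ∃ s ∈ R j, ∃ t ∈ R ℓ, geoDist s t < ε} : ℝ)
        ≤ ((T.filter fun q => dist q (p j) < 3 * ε).card : ℝ) := by exact_mod_cast hncard
      _ ≤ 7 ^ (m + 1) := card_filter_dist_lt_le_of_separated hε hsep (p j)
      _ ≤ _ := by linarith [show (0 : ℝ) ≤ (m + 1) * 2 ^ (2 * m + 1) by positivity]
  · have hempty : Metric.sphere (0 : EuclideanSpace ℝ (Fin (m + 1))) 1 \ ⋃ j, R j = ∅ := by
      refine Set.sdiff_eq_empty.2 fun x hx => ?_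
      obtain ⟨q, hq, hxq⟩ := hcover x hx
      have hex : ∃ j, dist x (p j) < ε := ⟨T.equivFin ⟨q, hq⟩, by simpa [p] using hxq⟩
      obtain ⟨j, hj, hmin⟩ := WellFounded.has_min (wellFounded_lt (α := Fin T.card))
        {j | dist x (p j) < ε} hex
      refine Set.mem_iUnion.2 ⟨j, ⟨hx, hj⟩, fun hmem => ?_⟩
      obtain ⟨i, hij, hi⟩ := Set.mem_iUnion₂.1 hmem
      exact hmin i hi hij
    rw [hempty, measure_empty]
    exact zero_le
end

section
/- Let N ≥ 1 and let (W, Q) = (W_1,…,W_N, Q_1,…,Q_N) be a centered Gaussian random vector in ℝ^{2N} with E[W_j W_k] = E[Q_j Q_k] = δ_{jk} for all 1 ≤ j,k ≤ N, and set r^{(j,k)} = E[W_j Q_k]. Let h : ℝ^N → ℝ be measurable with E[h(W)²] < ∞ and with Hermite rank at least τ for some integer τ ≥ 1, i.e. E[(h(W) − E h(W)) · ∏_{j=1}^N He_{k_j}(W_j)] = 0 for every multi-index k ∈ ℕ^N with 1 ≤ |k| < τ. Define ψ = max( max_{1≤j≤N} ∑_{k=1}^N |r^{(j,k)}|, max_{1≤k≤N}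 ∑_{j=1}^N |r^{(j,k)}| ) and assume ψ ≤ 1. Then |Cov(h(W), h(Q))| ≤ ψ^τ · E[h(W)²]. -/
open MeasureTheory ProbabilityTheory Real

/-- The `n`-th probabilists' Hermite polynomial, as a function `ℝ → ℝ`. -/
noncomputable def hermiteFun (n : ℕ) (x : ℝ) : ℝ :=
  Polynomial.aeval x (Polynomial.hermite n)

theorem integrable_polynomial_mul_exp_gaussianReal (p : Polynomial ℝ) (a : ℝ) :
    Integrable (fun x => p.eval x * exp (a * x)) (gaussianReal 0 1) := by
  induction p using Polynomial.induction_on' with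
  | add p q hp hq =>
    simp only [Polynomial.eval_add, add_mul]
    exact hp.add hq
  | monomial n c =>
    have h := integrable_pow_mul_exp_of_mem_interior_integrableExpSet (X := id)
      (μ := gaussianReal 0 1) (v := a) (by simp) n
    simpa [mul_assoc] using h.const_mul c

theorem integrable_gaussianReal_iff {f : ℝ → ℝ} :
    Integrable f (gaussianReal 0 1) ↔ Integrable (fun x => gaussianPDFReal 0 1 x * f x) := by
  rw [gaussianReal_of_var_ne_zero _ one_ne_zero, integrable_withDensity_iff_integrable_smul'
    (measurable_gaussianPDF _ _) (ae_of_all _ fun _ => gaussianPDF_lt_top)]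
  simp

theorem hasDerivAt_gaussianPDFReal (x : ℝ) :
    HasDerivAt (gaussianPDFReal 0 1) (-x * gaussianPDFReal 0 1 x) x := by
  rw [gaussianPDFReal_def]
  have h := (((hasDerivAt_pow 2 x).neg.div_const 2).exp).const_mul ((√(2 * π))⁻¹)
  convert! h using 1
  · ext; simp
  · simp; ring

/-- Gaussian integration by parts against an exponential. -/
theorem integral_X_mul_sub_derivative_mul_exp_gaussianReal (p : Polynomial ℝ) (a : ℝ) :
    ∫ x, (Polynomial.X * p - p.derivative).eval x * exp (a * x) ∂gaussianReal 0 1 =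
      a * ∫ x, p.eval x * exp (a * x) ∂gaussianReal 0 1 := by
  have key : ∫ x, (Polynomial.X * p - p.derivative - Polynomial.C a * p).eval x * exp (a * x)
      ∂gaussianReal 0 1 = 0 := by
    rw [integral_gaussianReal_eq_integral_smul one_ne_zero]
    simp only [smul_eq_mul]
    rw [← neg_eq_zero, ← integral_neg]
    refine integral_eq_zero_of_hasDerivAt_of_integrable
      (f := fun x => gaussianPDFReal 0 1 x * (p.eval x * exp (a * x))) (fun x => ?_)
      (integrable_gaussianReal_iff.1 (integrable_polynomial_mul_exp_gaussianReal _ a)).neg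
      (integrable_gaussianReal_iff.1 (integrable_polynomial_mul_exp_gaussianReal p a))
    convert! (hasDerivAt_gaussianPDFReal x).mul
      ((p.hasDerivAt x).mul ((hasDerivAt_id x).const_mul a).exp) using 1
    simp
    ring
  rw [← sub_eq_zero, ← integral_const_mul, ← integral_sub
    (integrable_polynomial_mul_exp_gaussianReal _ a)
    ((integrable_polynomial_mul_exp_gaussianReal p a).const_mul a)]
  refine Eq.trans ?_ key
  refine integral_congr_ae (ae_of_all _ fun x => ?_)
  simp only [Polynomial.eval_sub, Polynomial.eval_mul, Polynomial.eval_C]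
  ring

theorem hermiteFun_eq_eval_map (n : ℕ) (x : ℝ) :
    hermiteFun n x = ((Polynomial.hermite n).map (Int.castRingHom ℝ)).eval x := by
  simp [hermiteFun, Polynomial.aeval_def, Polynomial.eval_map]

theorem integral_hermiteFun_mul_exp_gaussianReal (n : ℕ) (a : ℝ) :
    ∫ x, hermiteFun n x * exp (a * x) ∂gaussianReal 0 1 = a ^ n * exp (a ^ 2 / 2) := by
  induction n with
  | zero =>
    have h := congrFun (mgf_fun_id_gaussianReal (μ := 0) (v := 1)) a
    simpa [hermiteFun, mgf] using h
  | succ n ih =>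
    have h := integral_X_mul_sub_derivative_mul_exp_gaussianReal
      ((Polynomial.hermite n).map (Int.castRingHom ℝ)) a
    simp only [← hermiteFun_eq_eval_map] at h
    rw [ih] at h
    rw [pow_succ', mul_assoc, ← h]
    simp [hermiteFun_eq_eval_map, Polynomial.hermite_succ, Polynomial.derivative_map]

theorem integrable_sq_hermiteFun_gaussianReal (n : ℕ) :
    Integrable (fun x => hermiteFun n x ^ 2) (gaussianReal 0 1) := by
  have h := integrable_polynomial_mul_exp_gaussianReal
    (((Polynomial.hermite n).map (Int.castRingHom ℝ)) ^ 2) 0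
  simp only [Polynomial.eval_pow, zero_mul, exp_zero, mul_one] at h
  simpa only [hermiteFun_eq_eval_map] using h

theorem measurable_hermiteFun (n : ℕ) : Measurable (hermiteFun n) :=
  (Polynomial.continuous_aeval _).measurable

/-- A finite measure on `ℝ^N` with everywhere finite moment generating function is determined
by that function. -/
theorem measure_ext_of_integral_exp_eq {N : ℕ} {ν₁ ν₂ : Measure (Fin N → ℝ)}
    [IsFiniteMeasure ν₁] [IsFiniteMeasure ν₂]
    (h₁ : ∀ a : Fin N → ℝ, Integrable (fun x => exp (∑ j, a j * x j)) ν₁)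
    (h : ∀ a : Fin N → ℝ, ∫ x, exp (∑ j, a j * x j) ∂ν₁ = ∫ x, exp (∑ j, a j * x j) ∂ν₂) :
    ν₁ = ν₂ := by
  refine Measure.ext_of_charFunDual (funext fun L => ?_)
  have hL : ∀ x, L x = ∑ j, L (Pi.single j 1) * x j := fun x => by
    conv_lhs => rw [pi_eq_sum_univ' x, map_sum]
    refine Finset.sum_congr rfl fun j _ => ?_
    rw [map_smul, smul_eq_mul, mul_comm]
  have hexp : ∀ (t : ℝ) x, exp (t * L x) = exp (∑ j, t * L (Pi.single j 1) * x j) := fun t x => by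
    rw [hL, Finset.mul_sum]
    simp only [mul_assoc]
  have hmgf : mgf L ν₁ = mgf L ν₂ := by
    ext t
    simp only [mgf, hexp]
    exact h _
  have hset : integrableExpSet L ν₁ = Set.univ := by
    ext t
    simp only [integrableExpSet, Set.mem_ofPred_eq, Set.mem_univ, iff_true, hexp]
    exact h₁ _
  have hzero : ν₁ = 0 ↔ ν₂ = 0 := by
    have h0 := h 0
    simp only [Pi.zero_apply, zero_mul, Finset.sum_const_zero, exp_zero, integral_const,
      smul_eq_mul, mul_one] at h0
    rw [← Measure.measure_univ_eq_zero, ← Measure.measure_univ_eq_zero,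
      ← measureReal_eq_zero_iff, ← measureReal_eq_zero_iff, h0]
  have := eqOn_complexMGF_of_mgf' hmgf hzero (x := Complex.I) (by simp [hset])
  simpa [complexMGF, charFunDual_apply, mul_comm] using this

theorem inner_toLp_toLp {E : Type*} [MeasurableSpace E] {ν : Measure E} {f g : E → ℝ}
    (hf : MemLp f 2 ν) (hg : MemLp g 2 ν) :
    inner ℝ (hf.toLp f) (hg.toLp g) = ∫ x, f x * g x ∂ν := by
  rw [L2.inner_def]
  refine integral_congr_ae ?_
  filter_upwards [hf.coeFn_toLp, hg.coeFn_toLp] with x h₁ h₂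
  simp [h₁, h₂, mul_comm]

/-- The standard Gaussian measure on `ℝ^N`. -/
noncomputable def stdGaussianPi (N : ℕ) : Measure (Fin N → ℝ) :=
  Measure.pi fun _ => gaussianReal 0 1

instance (N : ℕ) : IsProbabilityMeasure (stdGaussianPi N) := by
  unfold stdGaussianPi
  infer_instance

/-- The product Hermite polynomial attached to the word `α`: each letter `j` contributes
`He_n (x j)` with `n` the number of its occurrences in `α`. -/
noncomputable def hermiteWord {N m : ℕ} (α : Fin m → Fin N) (x : Fin N → ℝ) : ℝ :=
  ∏ j, hermiteFun (Finset.card {t | α t = j}) (x j)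

section StdGaussian

variable {N : ℕ}

theorem exp_sum_mul_eq_prod (a x : Fin N → ℝ) :
    exp (∑ j, a j * x j) = ∏ j, exp (a j * x j) := exp_sum _ _

theorem integrable_exp_stdGaussianPi (a : Fin N → ℝ) :
    Integrable (fun x => exp (∑ j, a j * x j)) (stdGaussianPi N) := by
  simp only [exp_sum_mul_eq_prod]
  exact Integrable.fintype_prod fun j => integrable_exp_mul_gaussianReal (a j)

theorem integral_exp_stdGaussianPi (a : Fin N → ℝ) :
    ∫ x, exp (∑ j, a j * x j) ∂stdGaussianPi N = exp ((∑ j, a j * a j) / 2) := by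
  simp only [exp_sum_mul_eq_prod, stdGaussianPi]
  rw [integral_fintype_prod_eq_prod (fun j y => exp (a j * y)), Finset.sum_div, exp_sum]
  refine Finset.prod_congr rfl fun j _ => ?_
  have h := congrFun (mgf_fun_id_gaussianReal (μ := 0) (v := 1)) (a j)
  simpa [mgf, pow_two] using h

theorem memLp_exp_stdGaussianPi (a : Fin N → ℝ) :
    MemLp (fun x => exp (∑ j, a j * x j)) 2 (stdGaussianPi N) := by
  refine (memLp_two_iff_integrable_sq
    (by fun_prop : Measurable _).aestronglyMeasurable).2 ?_
  convert integrable_exp_stdGaussianPi (fun j => 2 * a j) using 2 with x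
  rw [← exp_nat_mul, Finset.mul_sum]
  simp [mul_assoc]

theorem memLp_hermiteWord {m : ℕ} (α : Fin m → Fin N) :
    MemLp (hermiteWord α) 2 (stdGaussianPi N) := by
  have hmeas : Measurable (hermiteWord α) :=
    Finset.measurable_prod _ fun j _ => (measurable_hermiteFun _).comp (measurable_pi_apply j)
  refine (memLp_two_iff_integrable_sq hmeas.aestronglyMeasurable).2 ?_
  simp only [hermiteWord, ← Finset.prod_pow]
  exact Integrable.fintype_prod fun j => integrable_sq_hermiteFun_gaussianReal _

theorem integral_exp_mul_hermiteWord {m : ℕ} (α : Fin m → Fin N) (a : Fin N → ℝ) :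
    ∫ x, exp (∑ j, a j * x j) * hermiteWord α x ∂stdGaussianPi N =
      exp ((∑ j, a j * a j) / 2) * ∏ t, a (α t) := by
  simp only [exp_sum_mul_eq_prod, hermiteWord, ← Finset.prod_mul_distrib, stdGaussianPi]
  rw [integral_fintype_prod_eq_prod
    (fun j y => exp (a j * y) * hermiteFun (Finset.card {t | α t = j}) y),
    Finset.sum_div, exp_sum, ← Finset.prod_fiberwise Finset.univ α, ← Finset.prod_mul_distrib]
  refine Finset.prod_congr rfl fun j _ => ?_
  simp only [mul_comm (exp _) (hermiteFun _ _)]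
  rw [integral_hermiteFun_mul_exp_gaussianReal, mul_comm, ← pow_two]
  congr 1
  rw [Finset.prod_congr rfl (g := fun _ => a j), Finset.prod_const]
  intro t ht
  rw [(Finset.mem_filter.1 ht).2]

/-- The exponential function `x ↦ exp ⟨a, x⟩` as an element of the Gaussian `L²` space. -/
noncomputable def expLp (a : Fin N → ℝ) : Lp ℝ 2 (stdGaussianPi N) :=
  (memLp_exp_stdGaussianPi a).toLp _

theorem inner_expLp_expLp (a b : Fin N → ℝ) :
    inner ℝ (expLp a) (expLp b) =
      exp ((∑ j, a j * a j) / 2) * exp ((∑ j, b j * b j) / 2) * exp (∑ j, a j * b j) := by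
  have h : inner ℝ (expLp a) (expLp b) =
      ∫ x, exp (∑ j, (a j + b j) * x j) ∂stdGaussianPi N := by
    simp only [expLp, inner_toLp_toLp, add_mul, Finset.sum_add_distrib, exp_add]
  rw [h, integral_exp_stdGaussianPi, ← exp_add, ← exp_add, ← add_div, ← Finset.sum_add_distrib,
    Finset.sum_div, Finset.sum_div, ← Finset.sum_add_distrib]
  congr 1
  exact Finset.sum_congr rfl fun j _ => by ring

theorem inner_expLp_hermiteWord {m : ℕ} (α : Fin m → Fin N) (a : Fin N → ℝ) :
    inner ℝ (expLp a) ((memLp_hermiteWord α).toLp _) =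
      exp ((∑ j, a j * a j) / 2) * ∏ t, a (α t) := by
  rw [← integral_exp_mul_hermiteWord, expLp, inner_toLp_toLp]

theorem eq_zero_of_forall_inner_expLp (u : Lp ℝ 2 (stdGaussianPi N))
    (hu : ∀ a, inner ℝ (expLp a) u = 0) : u = 0 := by
  have hmem : MemLp u 2 (stdGaussianPi N) := Lp.memLp u
  have hint : Integrable u (stdGaussianPi N) := hmem.integrable one_le_two
  have hum : Measurable u := (Lp.stronglyMeasurable u).measurable
  have hprod (a : Fin N → ℝ) :
      Integrable (fun x => exp (∑ j, a j * x j) * u x) (stdGaussianPi N) :=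
    (memLp_exp_stdGaussianPi a).integrable_mul hmem
  have hzero (a : Fin N → ℝ) : ∫ x, exp (∑ j, a j * x j) * u x ∂stdGaussianPi N = 0 := by
    rw [← hu a, L2.inner_def]
    refine integral_congr_ae ?_
    filter_upwards [(memLp_exp_stdGaussianPi a).coeFn_toLp] with x hx
    simp [expLp, hx, mul_comm]
  have hpos (a : Fin N → ℝ) :
      Integrable (fun x => max (u x) 0 * exp (∑ j, a j * x j)) (stdGaussianPi N) := by
    refine (hprod a).pos_part.congr (ae_of_all _ fun x => ?_)
    simp only []
    rw [mul_comm (exp _), max_mul_of_nonneg _ _ (exp_pos _).le, zero_mul]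
  have hneg (a : Fin N → ℝ) :
      Integrable (fun x => max (-u x) 0 * exp (∑ j, a j * x j)) (stdGaussianPi N) := by
    refine (hprod a).neg_part.congr (ae_of_all _ fun x => ?_)
    simp only []
    rw [mul_comm (exp _), max_mul_of_nonneg _ _ (exp_pos _).le, zero_mul, neg_mul]
  have : IsFiniteMeasure ((stdGaussianPi N).withDensity fun x => ENNReal.ofReal (u x)) :=
    isFiniteMeasure_withDensity_ofReal hint.2
  have : IsFiniteMeasure ((stdGaussianPi N).withDensity fun x => ENNReal.ofReal (-u x)) :=
    isFiniteMeasure_withDensity_ofReal hint.neg.2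
  have heq : (stdGaussianPi N).withDensity (fun x => ENNReal.ofReal (u x)) =
      (stdGaussianPi N).withDensity fun x => ENNReal.ofReal (-u x) := by
    refine measure_ext_of_integral_exp_eq (fun a => ?_) (fun a => ?_)
    · rw [integrable_withDensity_iff_integrable_smul' (by fun_prop) (by simp)]
      simpa [ENNReal.toReal_ofReal'] using hpos a
    · rw [integral_withDensity_eq_integral_toReal_smul (by fun_prop) (by simp),
        integral_withDensity_eq_integral_toReal_smul (by fun_prop) (by simp), ← sub_eq_zero]
      simp only [ENNReal.toReal_ofReal', smul_eq_mul]
      rw [← integral_sub (hpos a) (hneg a)]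
      refine Eq.trans ?_ (hzero a)
      refine integral_congr_ae (ae_of_all _ fun x => ?_)
      simp only []
      rw [← sub_mul, max_zero_sub_max_neg_zero_eq_self, mul_comm]
  rw [withDensity_eq_iff (by fun_prop) (by fun_prop)
    (by simpa using (hint.lintegral_lt_top).ne)] at heq
  refine (Lp.eq_zero_iff_ae_eq_zero).2 ?_
  filter_upwards [heq] with x hx
  have h := congrArg ENNReal.toReal hx
  simp only [ENNReal.toReal_ofReal'] at h
  have := max_zero_sub_max_neg_zero_eq_self (u x)
  simp only [Pi.zero_apply]
  linarith

theorem dense_span_expLp :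
    Dense (Submodule.span ℝ (Set.range (expLp (N := N))) : Set (Lp ℝ 2 (stdGaussianPi N))) := by
  rw [Submodule.dense_iff_topologicalClosure_eq_top, Submodule.topologicalClosure_eq_top_iff,
    Submodule.eq_bot_iff]
  intro u hu
  refine eq_zero_of_forall_inner_expLp u fun a => ?_
  exact (Submodule.mem_orthogonal _ _).1 hu _ (Submodule.subset_span ⟨a, rfl⟩)

end StdGaussian

section Combinatorics

variable {N : ℕ} {ι : Type*}

/-- The `α`-entry of the tensor `∑ i, c i • (v i)^{⊗ m}`. -/
noncomputable def tensorSum (s : Finset ι) (c : ι → ℝ) (v : ι → Fin N → ℝ) {m : ℕ}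
    (α : Fin m → Fin N) : ℝ :=
  ∑ i ∈ s, c i * ∏ t, v i (α t)

theorem sum_mul_bilinear_pow_eq (s : Finset ι) (c : ι → ℝ) (v : ι → Fin N → ℝ)
    (r : Fin N → Fin N → ℝ) (m : ℕ) :
    ∑ i ∈ s, ∑ i' ∈ s, c i * c i' * (∑ j, ∑ k, v i j * v i' k * r j k) ^ m =
      ∑ α : Fin m → Fin N, ∑ β : Fin m → Fin N,
        tensorSum s c v α * tensorSum s c v β * ∏ t, r (α t) (β t) := by
  have hpow (i i' : ι) : (∑ j, ∑ k, v i j * v i' k * r j k) ^ m =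
      ∑ α : Fin m → Fin N, ∑ β : Fin m → Fin N,
        (∏ t, v i (α t)) * (∏ t, v i' (β t)) * ∏ t, r (α t) (β t) := by
    rw [Finset.sum_pow', Fintype.piFinset_univ]
    refine Finset.sum_congr rfl fun α _ => ?_
    rw [Finset.prod_univ_sum, Fintype.piFinset_univ]
    simp only [Finset.prod_mul_distrib]
  simp only [hpow, tensorSum, Finset.mul_sum, Finset.sum_mul]
  simp only [Finset.sum_comm (s := s) (t := (Finset.univ : Finset (Fin m → Fin N)))]
  refine Finset.sum_congr rfl fun α _ => Finset.sum_congr rfl fun β _ => ?_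
  rw [Finset.sum_comm]
  refine Finset.sum_congr rfl fun i _ => Finset.sum_congr rfl fun i' _ => ?_
  ring

theorem sum_mul_dot_pow_eq (s : Finset ι) (c : ι → ℝ) (v : ι → Fin N → ℝ) (m : ℕ) :
    ∑ i ∈ s, ∑ i' ∈ s, c i * c i' * (∑ j, v i j * v i' j) ^ m =
      ∑ α : Fin m → Fin N, tensorSum s c v α ^ 2 := by
  simp only [Finset.sum_pow', Fintype.piFinset_univ, tensorSum, pow_two, Finset.mul_sum,
    Finset.sum_mul, Finset.prod_mul_distrib]
  simp only [Finset.sum_comm (s := s) (t := (Finset.univ : Finset (Fin m → Fin N)))]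
  refine Finset.sum_congr rfl fun α _ => ?_
  rw [Finset.sum_comm]
  refine Finset.sum_congr rfl fun i _ => Finset.sum_congr rfl fun i' _ => ?_
  ring

/-- Schur's test for a symmetric bound on row and column sums. -/
theorem abs_sum_mul_mul_le_of_sum_abs_le {κ : Type*} [Fintype κ] (A : κ → ℝ) (M : κ → κ → ℝ)
    {C : ℝ} (hrow : ∀ α, ∑ β, |M α β| ≤ C) (hcol : ∀ β, ∑ α, |M α β| ≤ C) :
    |∑ α, ∑ β, A α * A β * M α β| ≤ C * ∑ α, A α ^ 2 := by
  have hterm (α β : κ) : |A α * A β * M α β| ≤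
      A α ^ 2 / 2 * |M α β| + A β ^ 2 / 2 * |M α β| := by
    rw [abs_mul, abs_mul, ← add_mul]
    refine mul_le_mul_of_nonneg_right ?_ (abs_nonneg _)
    nlinarith [sq_nonneg (|A α| - |A β|), sq_abs (A α), sq_abs (A β)]
  calc |∑ α, ∑ β, A α * A β * M α β|
      ≤ ∑ α, ∑ β, |A α * A β * M α β| :=
        (Finset.abs_sum_le_sum_abs _ _).trans
          (Finset.sum_le_sum fun α _ => Finset.abs_sum_le_sum_abs _ _)
    _ ≤ ∑ α, ∑ β, (A α ^ 2 / 2 * |M α β| + A β ^ 2 / 2 * |M α β|) :=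
        Finset.sum_le_sum fun α _ => Finset.sum_le_sum fun β _ => hterm α β
    _ = ∑ α, A α ^ 2 / 2 * ∑ β, |M α β| + ∑ β, A β ^ 2 / 2 * ∑ α, |M α β| := by
        simp only [Finset.sum_add_distrib, Finset.mul_sum]
        congr 1
        exact Finset.sum_comm
    _ ≤ ∑ α, A α ^ 2 / 2 * C + ∑ β, A β ^ 2 / 2 * C := by
        gcongr with α _ β _
        · exact hrow α
        · exact hcol β
    _ = C * ∑ α, A α ^ 2 := by
        rw [← Finset.sum_add_distrib, Finset.mul_sum]
        exact Finset.sum_congr rfl fun α _ => by ring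

theorem sum_abs_prod_le {r : Fin N → Fin N → ℝ} {ψ : ℝ} (hr : ∀ j, ∑ k, |r j k| ≤ ψ) {m : ℕ}
    (α : Fin m → Fin N) : ∑ β : Fin m → Fin N, |∏ t, r (α t) (β t)| ≤ ψ ^ m := by
  have h := Finset.prod_univ_sum (fun _ : Fin m => (Finset.univ : Finset (Fin N)))
    (fun t k => |r (α t) k|)
  rw [Fintype.piFinset_univ] at h
  simp only [Finset.abs_prod]
  rw [← h]
  refine (Finset.prod_le_prod (fun t _ => Finset.sum_nonneg fun k _ => abs_nonneg _)
    fun t _ => hr (α t)).trans_eq ?_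
  simp

theorem hasSum_sum_mul_exp (s : Finset ι) (c : ι → ℝ) (B : ι → ι → ℝ) :
    HasSum (fun m : ℕ => (∑ i ∈ s, ∑ i' ∈ s, c i * c i' * B i i' ^ m) / m.factorial)
      (∑ i ∈ s, ∑ i' ∈ s, c i * c i' * exp (B i i')) := by
  simp only [Finset.sum_div]
  refine hasSum_sum fun i _ => hasSum_sum fun i' _ => ?_
  have h := (NormedSpace.expSeries_div_hasSum_exp (B i i')).mul_left (c i * c i')
  rw [← Real.exp_eq_exp_ℝ] at h
  simpa only [mul_div_assoc] using h

theorem abs_sum_mul_exp_bilinear_le (s : Finset ι) (c : ι → ℝ) (v : ι → Fin N → ℝ)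
    {r : Fin N → Fin N → ℝ} {ψ : ℝ} (hψ0 : 0 ≤ ψ) (hψ1 : ψ ≤ 1)
    (hrow : ∀ j, ∑ k, |r j k| ≤ ψ) (hcol : ∀ k, ∑ j, |r j k| ≤ ψ) (τ : ℕ) :
    |∑ i ∈ s, ∑ i' ∈ s, c i * c i' * exp (∑ j, ∑ k, v i j * v i' k * r j k)| ≤
      ψ ^ τ * (∑ i ∈ s, ∑ i' ∈ s, c i * c i' * exp (∑ j, v i j * v i' j)) +
        ∑ m ∈ Finset.range τ,
          (∑ α : Fin m → Fin N, tensorSum s c v α ^ 2) / m.factorial := by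
  have hL := hasSum_sum_mul_exp s c fun i i' => ∑ j, ∑ k, v i j * v i' k * r j k
  have hS := (hasSum_sum_mul_exp s c fun i i' => ∑ j, v i j * v i' j).mul_left (ψ ^ τ)
  simp only [sum_mul_bilinear_pow_eq] at hL
  simp only [sum_mul_dot_pow_eq] at hS
  have hlow : HasSum (fun m : ℕ => if m ∈ Finset.range τ then
      (∑ α : Fin m → Fin N, tensorSum s c v α ^ 2) / m.factorial else 0)
      (∑ m ∈ Finset.range τ, (∑ α : Fin m → Fin N, tensorSum s c v α ^ 2) / m.factorial) := by
    have h := hasSum_sum_of_ne_finset_zero (L := .unconditional ℕ)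
      (s := Finset.range τ) (f := fun m : ℕ =>
      if m ∈ Finset.range τ then
        (∑ α : Fin m → Fin N, tensorSum s c v α ^ 2) / m.factorial else 0)
      (fun m hm => if_neg hm)
    rwa [Finset.sum_congr rfl fun m hm => if_pos hm] at h
  refine hL.norm_le_of_bounded (hS.add hlow) fun m => ?_
  have hschur := abs_sum_mul_mul_le_of_sum_abs_le (tensorSum s c v (m := m))
    (fun α β => ∏ t, r (α t) (β t)) (sum_abs_prod_le hrow)
    (fun β => sum_abs_prod_le (r := fun k j => r j k) hcol β)
  have hnn : 0 ≤ ∑ α : Fin m → Fin N, tensorSum s c v α ^ 2 :=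
    Finset.sum_nonneg fun α _ => sq_nonneg _
  have hfac : (0 : ℝ) < m.factorial := by positivity
  rw [norm_div, Real.norm_eq_abs, Real.norm_eq_abs, abs_of_pos hfac]
  refine (div_le_div_of_nonneg_right hschur hfac.le).trans ?_
  rw [mul_div_assoc]
  have hq : 0 ≤ (∑ α : Fin m → Fin N, tensorSum s c v α ^ 2) / m.factorial := by positivity
  by_cases hm : m < τ
  · rw [if_pos (Finset.mem_range.2 hm)]
    have h1 : ψ ^ m ≤ 1 := pow_le_one₀ hψ0 hψ1
    have h2 : 0 ≤ ψ ^ τ := pow_nonneg hψ0 τ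
    nlinarith
  · rw [if_neg (by simpa using hm), add_zero]
    exact mul_le_mul_of_nonneg_right (pow_le_pow_of_le_one hψ0 hψ1 (not_lt.1 hm)) hq

end Combinatorics

section JointLaw

variable {Ω : Type*} [MeasurableSpace Ω] {μ : Measure Ω} {N : ℕ}

theorem integral_sum_mul_sum_mul {U V : Ω → Fin N → ℝ} (hU : ∀ j, MemLp (fun ω => U ω j) 2 μ)
    (hV : ∀ j, MemLp (fun ω => V ω j) 2 μ) (a b : Fin N → ℝ) :
    ∫ ω, (∑ j, a j * U ω j) * (∑ k, b k * V ω k) ∂μ =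
      ∑ j, ∑ k, a j * b k * ∫ ω, U ω j * V ω k ∂μ := by
  have hint (j k : Fin N) : Integrable (fun ω => a j * b k * (U ω j * V ω k)) μ :=
    ((hU j).integrable_mul (hV k)).const_mul _
  simp only [Finset.sum_mul_sum, ← integral_const_mul]
  rw [← integral_congr_ae (ae_of_all _ fun ω => Finset.sum_congr rfl fun j _ =>
    Finset.sum_congr rfl fun k _ => mul_mul_mul_comm (a j) (b k) (U ω j) (V ω k)),
    integral_finsetSum _ fun j _ => integrable_finsetSum _ fun k _ => hint j k]
  exact Finset.sum_congr rfl fun j _ => integral_finsetSum _ fun k _ => hint j k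

/-- The second moment of a centered Gaussian variable is its variance parameter. -/
theorem integral_sq_of_map_eq_gaussianReal {X : Ω → ℝ} (hX : Measurable X) {v : NNReal}
    (h : μ.map X = gaussianReal 0 v) : ∫ ω, X ω ^ 2 ∂μ = v := by
  have hv := variance_id_gaussianReal (μ := 0) (v := v)
  rw [variance_eq_integral aemeasurable_id, ← h,
    integral_map hX.aemeasurable (by fun_prop), integral_map hX.aemeasurable (by fun_prop)] at hv
  have h0 : ∫ ω, X ω ∂μ = 0 := by
    have := integral_id_gaussianReal (μ := 0) (v := v)
    rwa [← h, integral_map hX.aemeasurable (by fun_prop)] at this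
  simpa [h0] using hv

/-- `(W, Q)` is a centered Gaussian vector whose halves `W` and `Q` have identity covariance. -/
structure IsStdGaussianPair (μ : Measure Ω) (W Q : Ω → Fin N → ℝ) : Prop where
  measurable_left : Measurable W
  measurable_right : Measurable Q
  exists_map_eq : ∀ c c' : Fin N → ℝ, ∃ v : NNReal,
    μ.map (fun ω => (∑ j, c j * W ω j) + ∑ j, c' j * Q ω j) = gaussianReal 0 v
  cov_left : ∀ j k, ∫ ω, W ω j * W ω k ∂μ = if j = k then 1 else 0
  cov_right : ∀ j k, ∫ ω, Q ω j * Q ω k ∂μ = if j = k then 1 else 0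

namespace IsStdGaussianPair

variable {W Q : Ω → Fin N → ℝ}

theorem symm (h : IsStdGaussianPair μ W Q) : IsStdGaussianPair μ Q W where
  measurable_left := h.measurable_right
  measurable_right := h.measurable_left
  exists_map_eq c c' := by simpa only [add_comm] using h.exists_map_eq c' c
  cov_left := h.cov_right
  cov_right := h.cov_left

theorem memLp_coordinate (h : IsStdGaussianPair μ W Q) (j : Fin N) :
    MemLp (fun ω => W ω j) 2 μ := by
  obtain ⟨v, hv⟩ := h.exists_map_eq (Pi.single j 1) 0
  have hX : (fun ω => (∑ i, (Pi.single j 1 : Fin N → ℝ) i * W ω i) +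
      ∑ i, (0 : Fin N → ℝ) i * Q ω i) = fun ω => W ω j := by
    ext ω
    simp [Pi.single_apply]
  rw [hX] at hv
  have hid := memLp_id_gaussianReal (μ := 0) (v := v) 2
  rw [← hv] at hid
  exact hid.comp_of_map ((measurable_pi_apply j).comp h.measurable_left).aemeasurable

theorem memLp_linear (h : IsStdGaussianPair μ W Q) (a : Fin N → ℝ) :
    MemLp (fun ω => ∑ j, a j * W ω j) 2 μ :=
  memLp_finsetSum _ fun j _ => (h.memLp_coordinate j).const_mul (a j)

theorem integral_sq_linear (h : IsStdGaussianPair μ W Q) (a : Fin N → ℝ) :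
    ∫ ω, (∑ j, a j * W ω j) ^ 2 ∂μ = ∑ j, a j * a j := by
  simp only [pow_two]
  rw [integral_sum_mul_sum_mul h.memLp_coordinate h.memLp_coordinate]
  simp [h.cov_left]

theorem integral_exp (h : IsStdGaussianPair μ W Q) (a b : Fin N → ℝ) :
    ∫ ω, exp (∑ j, a j * W ω j) * exp (∑ j, b j * Q ω j) ∂μ =
      exp ((∑ j, a j * a j) / 2) * exp ((∑ j, b j * b j) / 2) *
        exp (∑ j, ∑ k, a j * b k * ∫ ω, W ω j * Q ω k ∂μ) := by
  obtain ⟨v, hv⟩ := h.exists_map_eq a b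
  have hmW := h.measurable_left
  have hmQ := h.measurable_right
  have hsq := integral_sq_of_map_eq_gaussianReal (by fun_prop) hv
  have hA := (h.memLp_linear a).integrable_sq
  have hB := (h.symm.memLp_linear b).integrable_sq
  have hAB := (h.memLp_linear a).integrable_mul (h.symm.memLp_linear b)
  have hexpand : ∫ ω, ((∑ j, a j * W ω j) + ∑ j, b j * Q ω j) ^ 2 ∂μ =
      (∑ j, a j * a j) + 2 * (∑ j, ∑ k, a j * b k * ∫ ω, W ω j * Q ω k ∂μ) +
        ∑ j, b j * b j := by
    rw [← h.integral_sq_linear a, ← h.symm.integral_sq_linear b,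
      ← integral_sum_mul_sum_mul h.memLp_coordinate h.symm.memLp_coordinate,
      ← integral_const_mul]
    refine Eq.trans (integral_congr_ae (ae_of_all _ fun ω => ?_))
      ((integral_add (hA.add (hAB.const_mul 2)) hB).trans
        (congrArg (· + _) (integral_add hA (hAB.const_mul 2))))
    simp only [Pi.add_apply, Pi.mul_apply]
    ring
  have hmgf := mgf_gaussianReal hv 1
  simp only [mgf, one_mul, exp_add] at hmgf
  rw [hmgf, ← exp_add, ← exp_add, ← hsq, hexpand, ← exp_add]
  congr 1
  ring

variable [IsProbabilityMeasure μ]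

theorem measurePreserving (h : IsStdGaussianPair μ W Q) :
    MeasurePreserving W μ (stdGaussianPi N) where
  measurable := h.measurable_left
  map_eq := by
    have : IsProbabilityMeasure (μ.map W) :=
      Measure.isProbabilityMeasure_map h.measurable_left.aemeasurable
    refine (measure_ext_of_integral_exp_eq integrable_exp_stdGaussianPi fun a => ?_).symm
    rw [integral_exp_stdGaussianPi, integral_map h.measurable_left.aemeasurable
      (by fun_prop : Measurable _).aestronglyMeasurable]
    simpa using (h.integral_exp a 0).symm

theorem integral_comp (h : IsStdGaussianPair μ W Q) {F : (Fin N → ℝ) → ℝ}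
    (hF : AEStronglyMeasurable F (stdGaussianPi N)) :
    ∫ ω, F (W ω) ∂μ = ∫ x, F x ∂stdGaussianPi N := by
  rw [← h.measurePreserving.map_eq] at hF ⊢
  exact (integral_map h.measurable_left.aemeasurable hF).symm

theorem inner_expLp_comp (h : IsStdGaussianPair μ W Q) (a b : Fin N → ℝ) :
    inner ℝ (Lp.compMeasurePreserving W h.measurePreserving (expLp a))
        (Lp.compMeasurePreserving Q h.symm.measurePreserving (expLp b)) =
      exp ((∑ j, a j * a j) / 2) * exp ((∑ j, b j * b j) / 2) *
        exp (∑ j, ∑ k, a j * b k * ∫ ω, W ω j * Q ω k ∂μ) := by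
  rw [← h.integral_exp, expLp, expLp, Lp.toLp_compMeasurePreserving,
    Lp.toLp_compMeasurePreserving, inner_toLp_toLp]
  rfl

theorem abs_inner_comp_le (h : IsStdGaussianPair μ W Q) {ψ : ℝ} (hψ0 : 0 ≤ ψ) (hψ1 : ψ ≤ 1)
    (hrow : ∀ j, ∑ k, |∫ ω, W ω j * Q ω k ∂μ| ≤ ψ)
    (hcol : ∀ k, ∑ j, |∫ ω, W ω j * Q ω k ∂μ| ≤ ψ) (τ : ℕ)
    (f : Lp ℝ 2 (stdGaussianPi N)) :
    |inner ℝ (Lp.compMeasurePreserving W h.measurePreserving f)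
        (Lp.compMeasurePreserving Q h.symm.measurePreserving f)| ≤
      ψ ^ τ * inner ℝ f f + ∑ m ∈ Finset.range τ,
        (∑ α : Fin m → Fin N, inner ℝ f ((memLp_hermiteWord α).toLp _) ^ 2) / m.factorial := by
  have hclosed : IsClosed {f : Lp ℝ 2 (stdGaussianPi N) |
      |inner ℝ (Lp.compMeasurePreserving W h.measurePreserving f)
        (Lp.compMeasurePreserving Q h.symm.measurePreserving f)| ≤
      ψ ^ τ * inner ℝ f f + ∑ m ∈ Finset.range τ,
        (∑ α : Fin m → Fin N, inner ℝ f ((memLp_hermiteWord α).toLp _) ^ 2) / m.factorial} := by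
    have hcW := (Lp.isometry_compMeasurePreserving (E := ℝ) (p := 2)
      h.measurePreserving).continuous
    have hcQ := (Lp.isometry_compMeasurePreserving (E := ℝ) (p := 2)
      h.symm.measurePreserving).continuous
    exact isClosed_le (by fun_prop) (by fun_prop)
  refine dense_span_expLp.induction ?_ hclosed f
  intro f hf
  obtain ⟨c, rfl⟩ := Finsupp.mem_span_range_iff_exists_finsupp.1 hf
  have hmain := abs_sum_mul_exp_bilinear_le c.support
    (fun a => c a * exp ((∑ j, a j * a j) / 2)) id hψ0 hψ1 hrow hcol τ
  have hcomp {V : Ω → Fin N → ℝ} (hV : MeasurePreserving V μ (stdGaussianPi N)) :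
      Lp.compMeasurePreserving V hV (c.sum fun a t => t • expLp a) =
        ∑ a ∈ c.support, c a • Lp.compMeasurePreserving V hV (expLp a) := by
    rw [Finsupp.sum, map_sum]
    exact Finset.sum_congr rfl fun a _ => (Lp.compMeasurePreservingₗ ℝ V hV).map_smul (c a) _
  have htensor {m : ℕ} (α : Fin m → Fin N) :
      inner ℝ (c.sum fun a t => t • expLp a) ((memLp_hermiteWord α).toLp _) =
        tensorSum c.support (fun a => c a * exp ((∑ j, a j * a j) / 2)) id α := by
    simp only [Finsupp.sum, sum_inner, real_inner_smul_left, inner_expLp_hermiteWord, tensorSum,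
      mul_assoc, id]
  have hself : inner ℝ (c.sum fun a t => t • expLp a) (c.sum fun a t => t • expLp a) =
      ∑ a ∈ c.support, ∑ b ∈ c.support, c a * exp ((∑ j, a j * a j) / 2) *
        (c b * exp ((∑ j, b j * b j) / 2)) * exp (∑ j, a j * b j) := by
    simp only [Finsupp.sum, sum_inner, inner_sum, real_inner_smul_left, real_inner_smul_right,
      inner_expLp_expLp]
    rw [Finset.sum_comm]
    exact Finset.sum_congr rfl fun a _ => Finset.sum_congr rfl fun b _ => by ring
  have hcross : inner ℝ (Lp.compMeasurePreserving W h.measurePreserving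
        (c.sum fun a t => t • expLp a))
      (Lp.compMeasurePreserving Q h.symm.measurePreserving (c.sum fun a t => t • expLp a)) =
      ∑ a ∈ c.support, ∑ b ∈ c.support, c a * exp ((∑ j, a j * a j) / 2) *
        (c b * exp ((∑ j, b j * b j) / 2)) *
          exp (∑ j, ∑ k, a j * b k * ∫ ω, W ω j * Q ω k ∂μ) := by
    simp only [hcomp, sum_inner, inner_sum, real_inner_smul_left, real_inner_smul_right,
      h.inner_expLp_comp]
    rw [Finset.sum_comm]
    exact Finset.sum_congr rfl fun a _ => Finset.sum_congr rfl fun b _ => by ring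
  simp only [hcross, hself, htensor]
  exact hmain

/-- Arcones' inequality for a function orthogonal to all Hermite products of degree `< τ`. -/
theorem abs_integral_mul_le (h : IsStdGaussianPair μ W Q) {ψ : ℝ} (hψ0 : 0 ≤ ψ) (hψ1 : ψ ≤ 1)
    (hrow : ∀ j, ∑ k, |∫ ω, W ω j * Q ω k ∂μ| ≤ ψ)
    (hcol : ∀ k, ∑ j, |∫ ω, W ω j * Q ω k ∂μ| ≤ ψ) (τ : ℕ)
    {g : (Fin N → ℝ) → ℝ} (hg : MemLp g 2 (stdGaussianPi N))
    (horth : ∀ m < τ, ∀ α : Fin m → Fin N, ∫ ω, g (W ω) * hermiteWord α (W ω) ∂μ = 0) :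
    |∫ ω, g (W ω) * g (Q ω) ∂μ| ≤ ψ ^ τ * ∫ ω, g (W ω) ^ 2 ∂μ := by
  have hmain := h.abs_inner_comp_le hψ0 hψ1 hrow hcol τ (hg.toLp g)
  have hcross : inner ℝ (Lp.compMeasurePreserving W h.measurePreserving (hg.toLp g))
      (Lp.compMeasurePreserving Q h.symm.measurePreserving (hg.toLp g)) =
      ∫ ω, g (W ω) * g (Q ω) ∂μ := by
    rw [Lp.toLp_compMeasurePreserving, Lp.toLp_compMeasurePreserving, inner_toLp_toLp]
    rfl
  have hself : inner ℝ (hg.toLp g) (hg.toLp g) = ∫ ω, g (W ω) ^ 2 ∂μ := by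
    simp only [inner_toLp_toLp, pow_two]
    exact (h.integral_comp (hg.1.mul hg.1)).symm
  have hherm (m : ℕ) (hm : m < τ) (α : Fin m → Fin N) :
      inner ℝ (hg.toLp g) ((memLp_hermiteWord α).toLp _) = 0 := by
    rw [inner_toLp_toLp, ← horth m hm α]
    exact (h.integral_comp (hg.1.mul (memLp_hermiteWord α).1)).symm
  rw [hcross, hself, Finset.sum_eq_zero, add_zero] at hmain
  · exact hmain
  · intro m hm
    simp [hherm m (Finset.mem_range.1 hm)]

end IsStdGaussianPair

end JointLaw

/-- Arcones' inequality: if `(W,Q)` is a centered Gaussian vector in `ℝ^{2N}` whose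
two halves are standard (identity covariance), `h` is square integrable with Hermite
rank at least `τ ≥ 1`, and the Arcones coefficient
`ψ = max(max_j ∑_k |E[W_j Q_k]|, max_k ∑_j |E[W_j Q_k]|)` satisfies `ψ ≤ 1`, then
`|Cov(h(W), h(Q))| ≤ ψ^τ E[h(W)²]`. -/
theorem arcones_inequality
    {Ω : Type*} [MeasurableSpace Ω] (μ : Measure Ω) [IsProbabilityMeasure μ]
    (N : ℕ) (hN : 1 ≤ N) (W Q : Ω → Fin N → ℝ)
    (hW : Measurable W) (hQ : Measurable Q)
    -- `(W, Q)` is a centered Gaussian vector: every linear combination of its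
    -- coordinates has a centered Gaussian law.
    (hGauss : ∀ c c' : Fin N → ℝ, ∃ v : NNReal,
      μ.map (fun ω => (∑ j, c j * W ω j) + ∑ j, c' j * Q ω j) = gaussianReal 0 v)
    -- identity covariances of `W` and of `Q`
    (hWcov : ∀ j k, ∫ ω, W ω j * W ω k ∂μ = if j = k then 1 else 0)
    (hQcov : ∀ j k, ∫ ω, Q ω j * Q ω k ∂μ = if j = k then 1 else 0)
    (r : Fin N → Fin N → ℝ) (hr : ∀ j k, r j k = ∫ ω, W ω j * Q ω k ∂μ)
    (h : (Fin N → ℝ) → ℝ) (hmeas : Measurable h)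
    (hL2 : Integrable (fun ω => h (W ω) ^ 2) μ)
    (τ : ℕ) (hτ : 1 ≤ τ)
    -- `h` has Hermite rank at least `τ`
    (hrank : ∀ k : Fin N → ℕ, 1 ≤ ∑ j, k j → ∑ j, k j < τ →
      ∫ ω, (h (W ω) - ∫ ω', h (W ω') ∂μ) * ∏ j, hermiteFun (k j) (W ω j) ∂μ = 0)
    (ψ : ℝ)
    (hψ : ψ = max (⨆ j, ∑ k, |r j k|) (⨆ k, ∑ j, |r j k|))
    (hψ1 : ψ ≤ 1) :
    |(∫ ω, h (W ω) * h (Q ω) ∂μ) - (∫ ω, h (W ω) ∂μ) * ∫ ω, h (Q ω) ∂μ|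
      ≤ ψ ^ τ * ∫ ω, h (W ω) ^ 2 ∂μ := by
  have hp : IsStdGaussianPair μ W Q := ⟨hW, hQ, hGauss, hWcov, hQcov⟩
  have hψ0 : 0 ≤ ψ := by
    rw [hψ]
    exact le_max_of_le_left
      (Real.iSup_nonneg fun j => Finset.sum_nonneg fun k _ => abs_nonneg _)
  have hrow (j : Fin N) : ∑ k, |∫ ω, W ω j * Q ω k ∂μ| ≤ ψ := by
    simp only [← hr, hψ]
    exact le_max_of_le_left
      (le_ciSup (f := fun j => ∑ k, |r j k|) (Set.finite_range _).bddAbove j)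
  have hcol (k : Fin N) : ∑ j, |∫ ω, W ω j * Q ω k ∂μ| ≤ ψ := by
    simp only [← hr, hψ]
    exact le_max_of_le_right
      (le_ciSup (f := fun k => ∑ j, |r j k|) (Set.finite_range _).bddAbove k)
  have hmem : MemLp h 2 (stdGaussianPi N) := by
    refine (memLp_two_iff_integrable_sq hmeas.aestronglyMeasurable).2 ?_
    exact (hp.measurePreserving.integrable_comp (hmeas.pow_const 2).aestronglyMeasurable).1 hL2
  have hWmem : MemLp (fun ω => h (W ω)) 2 μ := hmem.comp_measurePreserving hp.measurePreserving
  have hQmem : MemLp (fun ω => h (Q ω)) 2 μ :=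
    hmem.comp_measurePreserving hp.symm.measurePreserving
  have hmean : ∫ ω, h (Q ω) ∂μ = ∫ ω, h (W ω) ∂μ := by
    rw [hp.integral_comp hmem.1, hp.symm.integral_comp hmem.1]
  set e := ∫ ω, h (W ω) ∂μ with he
  have horth : ∀ m < τ, ∀ α : Fin m → Fin N,
      ∫ ω, (h (W ω) - e) * hermiteWord α (W ω) ∂μ = 0 := by
    intro m hm α
    have hcard : ∑ j, Finset.card {t | α t = j} = m := by
      rw [← Finset.card_eq_sum_card_fiberwise fun t _ => Finset.mem_univ (α t)]
      simp
    rcases Nat.eq_zero_or_pos m with rfl | hpos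
    · simp [hermiteWord, hermiteFun, integral_sub (hWmem.integrable one_le_two) (integrable_const e),
        ← he]
    · exact hrank _ (by omega) (by omega)
  have hmain := hp.abs_integral_mul_le hψ0 hψ1 hrow hcol τ
    (g := fun x => h x - e) (hmem.sub (memLp_const e)) horth
  have hcov : ∫ ω, (h (W ω) - e) * (h (Q ω) - e) ∂μ = ∫ ω, h (W ω) * h (Q ω) ∂μ - e * e := by
    have hsub := covariance_eq_sub hWmem hQmem
    simpa only [covariance, hmean, ← he, Pi.mul_apply] using hsub
  have hvar : ∫ ω, (h (W ω) - e) ^ 2 ∂μ ≤ ∫ ω, h (W ω) ^ 2 ∂μ := by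
    have hle := variance_le_expectation_sq hWmem.1
    rwa [variance_eq_integral hWmem.1.aemeasurable] at hle
  rw [hcov] at hmain
  rw [hmean]
  exact hmain.trans (mul_le_mul_of_nonneg_left hvar (pow_nonneg hψ0 τ))
end

section
/- For all integers m ≥ 1 and d > 1, the expected number of roots of the m×m KSS system in ℝ^m equals d^{m/2}: E[N_{P_d}] = d^{m/2}. -/
open MeasureTheory ProbabilityTheory Real Filter Nat

/-- Index set for the coefficients of the `m × m` KSS system of degree `d`:
a pair of an equation index `ℓ ∈ {1,…,m}` and a multi-index `j ∈ ℕ^m` with `|j| ≤ d`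
(encoded with entries in `Fin (d+1)`). -/
abbrev kssIndex (m d : ℕ) :=
  Fin m × {j : Fin m → Fin (d + 1) // (∑ k, (j k : ℕ)) ≤ d}

/-- Variance `d! / (j_1! ⋯ j_m! (d - |j|)!)` of the coefficient `a^{(ℓ)}_j`. -/
noncomputable def kssVar (m d : ℕ) (i : kssIndex m d) : NNReal :=
  (d ! : NNReal) / ((∏ k, ((i.2.1 k : ℕ))! : ℕ) * ((d - ∑ k, (i.2.1 k : ℕ))! : ℕ))

/-- The law of the coefficients: product of independent centered Gaussian measures. -/
noncomputable def kssMeasure (m d : ℕ) : Measure (kssIndex m d → ℝ) :=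
  Measure.pi fun i => gaussianReal 0 (kssVar m d i)

/-- The polynomial `P_ℓ(t) = ∑_{|j| ≤ d} a^{(ℓ)}_j t^j`. -/
noncomputable def kssPoly (m d : ℕ) (ω : kssIndex m d → ℝ) (ℓ : Fin m)
    (t : Fin m → ℝ) : ℝ :=
  ∑ j : {j : Fin m → Fin (d + 1) // (∑ k, (j k : ℕ)) ≤ d},
    ω (ℓ, j) * ∏ k, t k ^ (j.1 k : ℕ)

/-- The number of roots of the system `P_d = 0` in `ℝ^m`. -/
noncomputable def kssCount (m d : ℕ) (ω : kssIndex m d → ℝ) : ℕ :=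
  Set.ncard {t : Fin m → ℝ | ∀ ℓ, kssPoly m d ω ℓ t = 0}

section AreaFormula

variable {E : Type*} [NormedAddCommGroup E] [NormedSpace ℝ E] [FiniteDimensional ℝ E]
  [MeasurableSpace E] [BorelSpace E]

/-- The set where the derivative is invertible splits into countably many measurable pieces on
which the map is injective. -/
theorem exists_partition_injOn_of_det_ne_zero {f : E → E} {f' : E → E →L[ℝ] E}
    (hf : ∀ x, HasFDerivAt f (f' x) x) :
    ∃ t : ℕ → Set E, Pairwise (Function.onFun Disjoint t) ∧ (∀ n, MeasurableSet (t n)) ∧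
      {x | (f' x).det ≠ 0} ⊆ ⋃ n, t n ∧ ∀ n, Set.InjOn f ({x | (f' x).det ≠ 0} ∩ t n) := by
  have key : ∀ A : E →L[ℝ] E, ∃ r : NNReal, r ≠ 0 ∧
      (A.det ≠ 0 → ∀ s : Set E, ApproximatesLinearOn f A s r → Set.InjOn f s) := by
    intro A
    by_cases hA : A.det = 0
    · exact ⟨1, one_ne_zero, fun h => absurd hA h⟩
    rcases subsingleton_or_nontrivial E with hE | hE
    · exact ⟨1, one_ne_zero, fun _ s _ => fun x _ y _ _ => Subsingleton.elim x y⟩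
    let B := A.toContinuousLinearEquivOfDetNeZero hA
    have hB : (B : E →L[ℝ] E) = A := ContinuousLinearMap.coe_toContinuousLinearEquivOfDetNeZero ..
    have hpos : 0 < ‖(B.symm : E →L[ℝ] E)‖₊ := B.nnnorm_symm_pos
    refine ⟨‖(B.symm : E →L[ℝ] E)‖₊⁻¹ / 2, by positivity, fun _ s hs => ?_⟩
    rw [← hB] at hs
    exact hs.injOn (Or.inr (NNReal.half_lt_self (by positivity)))
  choose r hr0 hr using key
  obtain ⟨t, A, ht1, ht2, ht3, ht4, ht5⟩ :=
    exists_partition_approximatesLinearOn_of_hasFDerivWithinAt f {x | (f' x).det ≠ 0} f'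
      (fun x _ => (hf x).hasFDerivWithinAt) r hr0
  refine ⟨t, ht1, ht2, ht3, fun n => ?_⟩
  rcases Set.eq_empty_or_nonempty {x | (f' x).det ≠ 0} with hS | hS
  · simp [hS]
  · obtain ⟨y, hy, hyA⟩ := ht5 hS n
    exact hr _ (hyA ▸ hy) _ (ht4 n)

/-- **Area formula** in equal dimensions: integral of the number of preimages. -/
theorem lintegral_count_preimage_mul (μ : Measure E) [μ.IsAddHaarMeasure]
    {f : E → E} {f' : E → E →L[ℝ] E}
    (hf : ∀ x, HasFDerivAt f (f' x) x) (hf' : Measurable f') {g : E → ENNReal}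
    (hg : Measurable g) :
    AEMeasurable (fun y => Measure.count (f ⁻¹' {y})) μ ∧
      ∫⁻ y, Measure.count (f ⁻¹' {y}) * g y ∂μ = ∫⁻ x, ENNReal.ofReal |(f' x).det| * g (f x) ∂μ := by
  obtain ⟨t, htd, htm, htS, hinj⟩ := exists_partition_injOn_of_det_ne_zero hf
  set S : Set E := {x | (f' x).det ≠ 0} with hSdef
  have hdet : Measurable fun x => (f' x).det :=
    ContinuousLinearMap.continuous_det.measurable.comp hf'
  have hS : MeasurableSet S := hdet (measurableSet_singleton 0).compl
  have hSt : ∀ n, MeasurableSet (S ∩ t n) := fun n => hS.inter (htm n)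
  have hd : ∀ s : Set E, ∀ x ∈ s, HasFDerivWithinAt f (f' x) s x :=
    fun s x _ => (hf x).hasFDerivWithinAt
  have him : ∀ n, MeasurableSet (f '' (S ∩ t n)) := fun n =>
    measurable_image_of_fderivWithin (hSt n) (hd _) (hinj n)
  have hcrit : μ (f '' Sᶜ) = 0 :=
    addHaar_image_eq_zero_of_det_fderivWithin_eq_zero μ (hd _) (fun x hx => by simpa [S] using hx)
  have hcount : ∀ y ∉ f '' Sᶜ,
      Measure.count (f ⁻¹' {y}) = ∑' n, (f '' (S ∩ t n)).indicator (fun _ => (1 : ENNReal)) y := by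
    intro y hy
    have hsub : ∀ n, (f ⁻¹' {y} ∩ (S ∩ t n)).Subsingleton := fun n a ha b hb =>
      hinj n ha.2 hb.2 (ha.1.trans hb.1.symm)
    have h1 : f ⁻¹' {y} = ⋃ n, f ⁻¹' {y} ∩ (S ∩ t n) := by
      ext x
      simp only [Set.mem_iUnion, Set.mem_inter_iff]
      refine ⟨fun hx => ?_, fun ⟨n, hx, _⟩ => hx⟩
      have hxS : x ∈ S := by
        by_contra h
        exact hy ⟨x, h, hx⟩
      obtain ⟨n, hn⟩ := Set.mem_iUnion.1 (htS hxS)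
      exact ⟨n, hx, hxS, hn⟩
    rw [h1, measure_iUnion]
    · refine tsum_congr fun n => ?_
      rcases (hsub n).eq_empty_or_singleton with h | ⟨a, ha⟩
      · rw [h, measure_empty, Set.indicator_of_notMem]
        rintro ⟨x, hx, hxy⟩
        exact (Set.eq_empty_iff_forall_notMem.1 h x) ⟨hxy, hx⟩
      · have haa : a ∈ f ⁻¹' {y} ∩ (S ∩ t n) := ha ▸ rfl
        rw [ha, Measure.count_singleton, Set.indicator_of_mem]
        exact ⟨a, haa.2, haa.1⟩
    · intro i j hij
      exact (htd hij).mono (fun x hx => hx.2.2) (fun x hx => hx.2.2)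
    · exact fun n => (hsub n).measurableSet
  have hmeas : ∀ n, Measurable ((f '' (S ∩ t n)).indicator (fun _ => (1 : ENNReal))) := fun n =>
    measurable_const.indicator (him n)
  have hae : (fun y => Measure.count (f ⁻¹' {y})) =ᵐ[μ]
      fun y => ∑' n, (f '' (S ∩ t n)).indicator (fun _ => (1 : ENNReal)) y := by
    filter_upwards [measure_eq_zero_iff_ae_notMem.1 hcrit] with y hy using hcount y hy
  refine ⟨⟨_, Measurable.tsum hmeas, hae⟩, ?_⟩
  calc ∫⁻ y, Measure.count (f ⁻¹' {y}) * g y ∂μ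
      = ∫⁻ y, ∑' n, (f '' (S ∩ t n)).indicator g y ∂μ := by
        refine lintegral_congr_ae (hae.mono fun y hy => ?_)
        simp only [] at hy ⊢
        rw [hy, ← ENNReal.tsum_mul_right]
        refine tsum_congr fun n => ?_
        by_cases h : y ∈ f '' (S ∩ t n) <;> simp [h]
    _ = ∑' n, ∫⁻ y in f '' (S ∩ t n), g y ∂μ := by
        rw [lintegral_tsum fun n => (hg.indicator (him n)).aemeasurable]
        exact tsum_congr fun n => lintegral_indicator (him n) _
    _ = ∑' n, ∫⁻ x in S ∩ t n, ENNReal.ofReal |(f' x).det| * g (f x) ∂μ :=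
        tsum_congr fun n =>
          lintegral_image_eq_lintegral_abs_det_fderiv_mul μ (hSt n) (hd _) (hinj n) g
    _ = ∫⁻ x in S, ENNReal.ofReal |(f' x).det| * g (f x) ∂μ := by
        rw [← lintegral_iUnion hSt, ← Set.inter_iUnion, Set.inter_eq_left.2 htS]
        intro i j hij
        exact (htd hij).mono Set.inter_subset_right Set.inter_subset_right
    _ = ∫⁻ x, ENNReal.ofReal |(f' x).det| * g (f x) ∂μ := by
        rw [← lintegral_indicator hS]
        refine lintegral_congr fun x => ?_
        by_cases h : x ∈ S
        · simp [h]
        · have : (f' x).det = 0 := by simpa [S] using h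
          simp [h, this]

end AreaFormula

section PiDensity

variable {ι : Type*} [Fintype ι] {X : ι → Type*} [∀ i, MeasurableSpace (X i)]
  {μ : ∀ i, Measure (X i)}

theorem lintegral_pi_prod [∀ i, SigmaFinite (μ i)] {f : ∀ i, X i → ENNReal}
    (hf : ∀ i, Measurable (f i)) :
    ∫⁻ x, ∏ i, f i (x i) ∂Measure.pi μ = ∏ i, ∫⁻ x, f i x ∂μ i := by
  classical
  by_cases hne : Nonempty (∀ i, X i)
  swap
  · have hX : ∃ i, IsEmpty (X i) := by
      by_contra! h
      exact hne ⟨fun i => (h i).some⟩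
    obtain ⟨i, hi⟩ := hX
    have : IsEmpty (∀ i, X i) := not_nonempty_iff.1 hne
    rw [lintegral_of_isEmpty, Finset.prod_eq_zero (Finset.mem_univ i) (lintegral_of_isEmpty ..)]
  obtain ⟨x₀⟩ := hne
  have key : ∀ s : Finset ι, ∀ x, (∫⋯∫⁻_s, (fun x => ∏ i, f i (x i)) ∂μ) x =
      (∏ i ∈ s, ∫⁻ y, f i y ∂μ i) * ∏ i ∈ sᶜ, f i (x i) := by
    intro s
    induction s using Finset.induction with
    | empty => intro x; simp
    | insert a s ha ih =>
      intro x
      rw [lmarginal_insert _ (by fun_prop) ha]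
      simp_rw [ih]
      have hc : sᶜ = insert a (insert a s)ᶜ := by
        ext i; by_cases h : i = a <;> simp [h, ha]
      have h1 : ∀ y : X a, (∏ i ∈ s, ∫⁻ y, f i y ∂μ i) *
          ∏ i ∈ sᶜ, f i (Function.update x a y i) =
          ((∏ i ∈ s, ∫⁻ y, f i y ∂μ i) * ∏ i ∈ (insert a s)ᶜ, f i (x i)) * f a y := by
        intro y
        rw [hc, Finset.prod_insert (by simp), Function.update_self, mul_assoc, mul_comm (f a y)]
        congr 2
        refine Finset.prod_congr rfl fun i hi => ?_
        rw [Function.update_of_ne]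
        rintro rfl
        simp at hi
      simp_rw [h1]
      rw [lintegral_const_mul _ (hf a), Finset.prod_insert ha]
      ring
  rw [lintegral_eq_lmarginal_univ x₀, key]
  simp

theorem pi_withDensity [∀ i, SigmaFinite (μ i)] {f : ∀ i, X i → ENNReal}
    (hf : ∀ i, Measurable (f i)) [∀ i, SigmaFinite ((μ i).withDensity (f i))] :
    Measure.pi (fun i => (μ i).withDensity (f i)) =
      (Measure.pi μ).withDensity fun x => ∏ i, f i (x i) := by
  classical
  refine Measure.pi_eq fun s hs => ?_
  rw [withDensity_apply _ (MeasurableSet.univ_pi hs), ← lintegral_indicator (.univ_pi hs)]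
  simp_rw [withDensity_apply _ (hs _), ← lintegral_indicator (hs _)]
  rw [← lintegral_pi_prod fun i => (hf i).indicator (hs i)]
  refine lintegral_congr fun x => ?_
  by_cases hx : x ∈ Set.univ.pi s
  · rw [Set.indicator_of_mem hx]
    exact Finset.prod_congr rfl fun i _ => (Set.indicator_of_mem (hx i trivial) _).symm
  · rw [Set.indicator_of_notMem hx]
    simp only [Set.mem_pi, not_forall] at hx
    obtain ⟨i, _, hi⟩ := hx
    exact (Finset.prod_eq_zero (Finset.mem_univ i) (Set.indicator_of_notMem hi _)).symm

end PiDensity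

section Tilted

variable {J : Type*} [Fintype J] {m : ℕ}

/-- The law of `∑ j, x j • g j` under the centered Gaussian product measure with variances `c`,
weighted by the standard normal density of `∑ j, x j * q j`. -/
noncomputable def tiltedGaussian (c : J → NNReal) (q : J → ℝ) (g : J → Fin m → ℝ) :
    Measure (Fin m → ℝ) :=
  ((Measure.pi fun j => gaussianReal 0 (c j)).withDensity
    fun x => gaussianPDF 0 1 (∑ j, x j * q j)).map fun x k => ∑ j, x j * g j k

theorem gaussianPDF_zero_one_le_one (x : ℝ) : gaussianPDF 0 1 x ≤ 1 := by
  rw [gaussianPDF, ENNReal.ofReal_le_one, gaussianPDFReal]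
  refine mul_le_one₀ (inv_le_one_of_one_le₀ ?_) (exp_nonneg _) (exp_le_one_iff.2 ?_)
  · rw [Real.one_le_sqrt]
    have := Real.pi_gt_three
    norm_num; linarith
  · simp only [sub_zero, NNReal.coe_one, mul_one]
    have := sq_nonneg x
    linarith

instance (c : J → NNReal) (q : J → ℝ) :
    IsFiniteMeasure ((Measure.pi fun j => gaussianReal 0 (c j)).withDensity
      fun x => gaussianPDF 0 1 (∑ j, x j * q j)) := by
  refine isFiniteMeasure_withDensity (ne_of_lt ?_)
  calc ∫⁻ x : J → ℝ, gaussianPDF 0 1 (∑ j, x j * q j) ∂(Measure.pi fun j => gaussianReal 0 (c j))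
      ≤ ∫⁻ x : J → ℝ, 1 ∂(Measure.pi fun j => gaussianReal 0 (c j)) :=
        lintegral_mono fun x => gaussianPDF_zero_one_le_one _
    _ < ⊤ := by simp

instance (c : J → NNReal) (q : J → ℝ) (g : J → Fin m → ℝ) :
    IsFiniteMeasure (tiltedGaussian c q g) := by
  unfold tiltedGaussian; infer_instance

theorem integral_cexp_pi_gaussianReal (c : J → NNReal) (b : J → ℝ) :
    ∫ x : J → ℝ, Complex.exp ((∑ j, x j * b j : ℝ) * Complex.I)
      ∂(Measure.pi fun j => gaussianReal 0 (c j)) =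
      Complex.exp ((-(∑ j, c j * b j ^ 2) / 2 : ℝ)) := by
  have h : ∀ x : J → ℝ, Complex.exp ((∑ j, x j * b j : ℝ) * Complex.I) =
      ∏ j, Complex.exp (b j * x j * Complex.I) := by
    intro x
    rw [← Complex.exp_sum, Complex.ofReal_sum, Finset.sum_mul]
    congr 1
    refine Finset.sum_congr rfl fun j _ => ?_
    push_cast; ring
  simp_rw [h]
  rw [integral_fintype_prod_eq_prod (f := fun j (x : ℝ) => Complex.exp (b j * x * Complex.I))]
  simp_rw [← charFun_apply_real, charFun_gaussianReal]
  rw [← Complex.exp_sum]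
  congr 1
  push_cast
  rw [neg_div, Finset.sum_div, ← Finset.sum_neg_distrib]
  refine Finset.sum_congr rfl fun j _ => ?_
  simp

theorem integral_gaussianReal_cexp_quadratic {u : ℝ} (hu : 0 ≤ u) (β V : ℝ) :
    ∫ a : ℝ, Complex.exp ((-(a ^ 2 * u + 2 * a * β + V) / 2 : ℝ)) ∂(gaussianReal 0 1) =
      ((√(1 + u))⁻¹ * Real.exp (-(V - β ^ 2 / (1 + u)) / 2) : ℝ) := by
  have hp : (0 : ℝ) < 1 + u := by linarith
  have h2π : (0 : ℝ) < 2 * π := by positivity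
  rw [integral_gaussianReal_eq_integral_smul one_ne_zero]
  have h : ∀ a : ℝ, gaussianPDFReal 0 1 a •
      Complex.exp ((-(a ^ 2 * u + 2 * a * β + V) / 2 : ℝ)) = ((√(2 * π))⁻¹ : ℝ) *
        Complex.exp (-((1 + u : ℝ) / 2 : ℂ) * a ^ 2 + (-β : ℂ) * a + (-V / 2 : ℂ)) := by
    intro a
    rw [gaussianPDFReal, Complex.real_smul]
    simp only [NNReal.coe_one, mul_one, sub_zero]
    rw [Complex.ofReal_mul, mul_assoc, Complex.ofReal_exp, ← Complex.exp_add]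
    congr 2
    push_cast; ring
  simp_rw [h]
  rw [integral_const_mul, integral_cexp_quadratic (by
    rw [← Complex.ofReal_ofNat, ← Complex.ofReal_div, ← Complex.ofReal_neg, Complex.ofReal_re]
    linarith)]
  have hs : ((π : ℂ) / - -((1 + u : ℝ) / 2 : ℂ)) ^ (1 / 2 : ℂ) = (√(2 * π / (1 + u)) : ℝ) := by
    rw [Real.sqrt_eq_rpow, Complex.ofReal_cpow (by positivity)]
    congr 1
    · push_cast; field_simp
    · push_cast; rfl
  rw [hs, Real.sqrt_div h2π.le]
  push_cast
  have h3 : ((√(2 * π) : ℝ) : ℂ) ≠ 0 := by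
    exact_mod_cast (Real.sqrt_pos.2 h2π).ne'
  have h4 : (1 + u : ℂ) ≠ 0 := by exact_mod_cast hp.ne'
  have h5 : ((√(1 + u) : ℝ) : ℂ) ≠ 0 := by
    exact_mod_cast (Real.sqrt_pos.2 hp).ne'
  have h6 : (-V / 2 - (-β) ^ 2 / (4 * -((1 + u) / 2)) : ℂ) = -(V - β ^ 2 / (1 + u)) / 2 := by
    field_simp; ring
  rw [h6]
  field_simp

theorem charFunDual_tiltedGaussian (c : J → NNReal) (q : J → ℝ) (g : J → Fin m → ℝ)
    (L : StrongDual ℝ (Fin m → ℝ)) :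
    charFunDual (tiltedGaussian c q g) L =
      ((√(2 * π))⁻¹ * ((√(1 + ∑ j, c j * q j ^ 2))⁻¹ *
        Real.exp (-(∑ j, c j * (L (g j)) ^ 2 -
          (∑ j, c j * q j * L (g j)) ^ 2 / (1 + ∑ j, c j * q j ^ 2)) / 2)) : ℝ) := by
  rw [charFunDual_apply, tiltedGaussian, integral_map
      (Measurable.aemeasurable (by fun_prop)) (by fun_prop),
    integral_withDensity_eq_integral_toReal_smul (by fun_prop)
      (ae_of_all _ fun x => (gaussianPDF_zero_one_le_one _).trans_lt ENNReal.one_lt_top)]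
  have hL : ∀ x : J → ℝ, L (fun k => ∑ j, x j * g j k) = ∑ j, x j * L (g j) := by
    intro x
    have : (fun k => ∑ j, x j * g j k) = ∑ j, x j • g j := by
      ext k; simp
    rw [this, map_sum]; simp
  have h : ∀ x : J → ℝ, (gaussianPDF 0 1 (∑ j, x j * q j)).toReal •
      Complex.exp (L (fun k => ∑ j, x j * g j k) * Complex.I) =
      ((√(2 * π))⁻¹ : ℝ) * ∫ a : ℝ, Complex.exp ((∑ j, x j * (a * q j + L (g j)) : ℝ) * Complex.I)
        ∂(gaussianReal 0 1) := by
    intro x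
    have h1 : ∀ a : ℝ, Complex.exp ((∑ j, x j * (a * q j + L (g j)) : ℝ) * Complex.I) =
        Complex.exp ((∑ j, x j * q j : ℝ) * a * Complex.I) *
          Complex.exp ((∑ j, x j * L (g j) : ℝ) * Complex.I) := by
      intro a
      rw [← Complex.exp_add, ← add_mul, ← Complex.ofReal_mul, ← Complex.ofReal_add,
        Finset.sum_mul, ← Finset.sum_add_distrib]
      congr 3
      exact Finset.sum_congr rfl fun j _ => by ring
    simp_rw [h1]
    rw [integral_mul_const, ← charFun_apply_real, charFun_gaussianReal, hL, toReal_gaussianPDF,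
      gaussianPDFReal, Complex.real_smul, Complex.ofReal_mul, ← mul_assoc]
    congr 2
    · simp
    · simp [neg_div]
  simp_rw [h]
  rw [integral_const_mul, integral_integral_swap]
  · simp_rw [integral_cexp_pi_gaussianReal]
    have hq : ∀ a : ℝ, ∑ j, (c j : ℝ) * (a * q j + L (g j)) ^ 2 =
        a ^ 2 * (∑ j, c j * q j ^ 2) + 2 * a * (∑ j, c j * q j * L (g j)) +
          ∑ j, c j * (L (g j)) ^ 2 := by
      intro a
      simp_rw [Finset.mul_sum, ← Finset.sum_add_distrib]
      exact Finset.sum_congr rfl fun j _ => by ring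
    simp_rw [hq]
    rw [integral_gaussianReal_cexp_quadratic
      (Finset.sum_nonneg fun j _ => by positivity), ← Complex.ofReal_mul]
  · refine (integrable_const (1 : ℝ)).mono' (by fun_prop) (ae_of_all _ fun p => ?_)
    simp only [Function.uncurry]
    rw [Complex.norm_exp_ofReal_mul_I]

end Tilted

section Kernel

variable {J : Type*} [Fintype J] {m d : ℕ}

/-- The covariance of the value and of a directional derivative, for a Gaussian field with
covariance `(1 + ⟨x, y⟩) ^ d` (up to the constant term). -/
theorem sum_mul_fderiv_of_kernel {c : J → ℝ} {f : J → (Fin m → ℝ) → ℝ}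
    (hf : ∀ j, Differentiable ℝ (f j))
    (hK : ∀ x y, 1 + ∑ j, c j * f j x * f j y = (1 + x ⬝ᵥ y) ^ d) (x t ξ : Fin m → ℝ) :
    ∑ j, c j * f j x * fderiv ℝ (f j) t ξ = d * (1 + x ⬝ᵥ t) ^ (d - 1) * (x ⬝ᵥ ξ) := by
  have hline : HasDerivAt (fun ε : ℝ => t + ε • ξ) ξ 0 := by
    simpa using ((hasDerivAt_id (0 : ℝ)).smul_const ξ).const_add t
  have h1 : HasDerivAt (fun ε : ℝ => 1 + ∑ j, c j * f j x * f j (t + ε • ξ))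
      (∑ j, c j * f j x * fderiv ℝ (f j) t ξ) 0 := by
    refine (HasDerivAt.fun_sum fun j _ => HasDerivAt.const_mul _ ?_).const_add _
    exact HasFDerivAt.comp_hasDerivAt (0 : ℝ) (by simpa using (hf j t).hasFDerivAt) hline
  have h2 : HasDerivAt (fun ε : ℝ => (1 + x ⬝ᵥ (t + ε • ξ)) ^ d)
      (d * (1 + x ⬝ᵥ t) ^ (d - 1) * (x ⬝ᵥ ξ)) 0 := by
    have : HasDerivAt (fun ε : ℝ => 1 + x ⬝ᵥ (t + ε • ξ)) (x ⬝ᵥ ξ) 0 := by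
      simp_rw [dotProduct_add, dotProduct_smul, smul_eq_mul]
      simpa using (((hasDerivAt_id (0 : ℝ)).mul_const (x ⬝ᵥ ξ)).const_add (x ⬝ᵥ t)).const_add 1
    simpa using this.fun_pow d
  simp_rw [hK] at h1
  exact h1.unique h2

/-- The covariance of two directional derivatives at the same point. -/
theorem sum_fderiv_sq_of_kernel {c : J → ℝ} {f : J → (Fin m → ℝ) → ℝ}
    (hf : ∀ j, Differentiable ℝ (f j))
    (hK : ∀ x y, 1 + ∑ j, c j * f j x * f j y = (1 + x ⬝ᵥ y) ^ d) (t ξ : Fin m → ℝ) :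
    ∑ j, c j * (fderiv ℝ (f j) t ξ) ^ 2 =
      d * ((d - 1 : ℕ) * (1 + t ⬝ᵥ t) ^ (d - 1 - 1) * (t ⬝ᵥ ξ) * (t ⬝ᵥ ξ) +
        (1 + t ⬝ᵥ t) ^ (d - 1) * (ξ ⬝ᵥ ξ)) := by
  have hline : HasDerivAt (fun ε : ℝ => t + ε • ξ) ξ 0 := by
    simpa using ((hasDerivAt_id (0 : ℝ)).smul_const ξ).const_add t
  have h1 : HasDerivAt (fun ε : ℝ => ∑ j, c j * f j (t + ε • ξ) * fderiv ℝ (f j) t ξ)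
      (∑ j, c j * (fderiv ℝ (f j) t ξ) ^ 2) 0 := by
    have : ∀ j, c j * (fderiv ℝ (f j) t ξ) ^ 2 =
        c j * (fderiv ℝ (f j) t ξ) * fderiv ℝ (f j) t ξ := fun j => by ring
    simp_rw [this]
    refine HasDerivAt.fun_sum fun j _ => (HasDerivAt.const_mul _ ?_).mul_const _
    exact HasFDerivAt.comp_hasDerivAt (0 : ℝ) (by simpa using (hf j t).hasFDerivAt) hline
  have h2 : HasDerivAt
      (fun ε : ℝ => d * ((1 + (t + ε • ξ) ⬝ᵥ t) ^ (d - 1) * ((t + ε • ξ) ⬝ᵥ ξ)))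
      (d * ((d - 1 : ℕ) * (1 + t ⬝ᵥ t) ^ (d - 1 - 1) * (t ⬝ᵥ ξ) * (t ⬝ᵥ ξ) +
        (1 + t ⬝ᵥ t) ^ (d - 1) * (ξ ⬝ᵥ ξ))) 0 := by
    have h3 : ∀ z : Fin m → ℝ, HasDerivAt (fun ε : ℝ => (t + ε • ξ) ⬝ᵥ z) (ξ ⬝ᵥ z) 0 := by
      intro z
      simp_rw [add_dotProduct, smul_dotProduct, smul_eq_mul]
      simpa using ((hasDerivAt_id (0 : ℝ)).mul_const (ξ ⬝ᵥ z)).const_add (t ⬝ᵥ z)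
    have h4 := (((h3 t).const_add 1).fun_pow (d - 1)).fun_mul (h3 ξ)
    simpa [dotProduct_comm ξ t] using h4.const_mul (d : ℝ)
  simp_rw [sum_mul_fderiv_of_kernel hf hK, mul_assoc (d : ℝ)] at h1
  exact h1.unique h2

theorem tiltedGaussian_eq_of_kernel (hd : 1 ≤ d) {c : J → NNReal} {f : J → (Fin m → ℝ) → ℝ}
    (hf : ∀ j, Differentiable ℝ (f j))
    (hK : ∀ x y, 1 + ∑ j, (c j : ℝ) * f j x * f j y = (1 + x ⬝ᵥ y) ^ d) (t : Fin m → ℝ) :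
    tiltedGaussian c (fun j => f j t) (fun j k => fderiv ℝ (f j) t (Pi.single k 1)) =
      ENNReal.ofReal (√((1 + t ⬝ᵥ t) ^ (d - 1)))⁻¹ • tiltedGaussian (fun _ => 1) t
        (fun j => √(d * (1 + t ⬝ᵥ t) ^ (d - 1)) • (Pi.single j 1 : Fin m → ℝ)) := by
  have := Measure.smul_finite (tiltedGaussian (fun _ => 1) t
    (fun j => √(d * (1 + t ⬝ᵥ t) ^ (d - 1)) • (Pi.single j 1 : Fin m → ℝ)))
    (ENNReal.ofReal_ne_top (r := (√((1 + t ⬝ᵥ t) ^ (d - 1)))⁻¹))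
  refine Measure.ext_of_charFunDual (funext fun L => ?_)
  have hs : 0 < 1 + t ⬝ᵥ t := by
    have : 0 ≤ t ⬝ᵥ t := Finset.sum_nonneg fun i _ => mul_self_nonneg _
    linarith
  have hL : ∀ v, L v = (fun k => L (Pi.single k 1)) ⬝ᵥ v := by
    intro v
    conv_lhs => rw [← Finset.univ_sum_single v, map_sum]
    refine Finset.sum_congr rfl fun k _ => ?_
    rw [mul_comm, ← smul_eq_mul, ← map_smul]
    congr 1
    ext i
    by_cases h : i = k
    · subst h; simp
    · simp [h]
  generalize hξ : (fun k => L (Pi.single k 1)) = ξ at hL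
  have hLg : ∀ j, L (fun k => fderiv ℝ (f j) t (Pi.single k 1)) = fderiv ℝ (f j) t ξ := by
    intro j
    rw [hL, dotProduct]
    conv_rhs => rw [← Finset.univ_sum_single ξ, map_sum]
    refine Finset.sum_congr rfl fun k _ => ?_
    rw [← smul_eq_mul, ← map_smul]
    congr 1
    ext i
    by_cases h : i = k
    · subst h; simp
    · simp [h]
  have hξk : ∀ k, L (Pi.single k 1) = ξ k := fun k => by rw [← hξ]
  obtain ⟨e, rfl⟩ : ∃ e, d = e + 1 := ⟨d - 1, by omega⟩
  have hu := hK t t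
  have hβ := sum_mul_fderiv_of_kernel hf hK t t ξ
  have hV := sum_fderiv_sq_of_kernel hf hK t ξ
  simp only [add_tsub_cancel_right] at hu hβ hV ⊢
  rw [charFunDual_tiltedGaussian, charFunDual_apply, integral_smul_measure, ← charFunDual_apply,
    charFunDual_tiltedGaussian]
  simp_rw [hLg, hβ, hV, map_smul, hξk, sq (f _ t), ← mul_assoc, hu]
  set s := 1 + t ⬝ᵥ t with hsdef
  have hl : √(((e + 1 : ℕ) : ℝ) * s ^ e) ^ 2 = (e + 1 : ℕ) * s ^ e := Real.sq_sqrt (by positivity)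
  generalize √(((e + 1 : ℕ) : ℝ) * s ^ e) = l at hl
  rw [ENNReal.toReal_ofReal (by positivity), Complex.real_smul, ← Complex.ofReal_mul]
  congr 1
  have h1 : ∑ j, ((1 : NNReal) : ℝ) * t j ^ 2 = t ⬝ᵥ t := by
    simp [dotProduct, sq]
  have h2 : ∑ j, ((1 : NNReal) : ℝ) * (l • ξ j) ^ 2 = l ^ 2 * (ξ ⬝ᵥ ξ) := by
    rw [dotProduct, Finset.mul_sum]
    refine Finset.sum_congr rfl fun j _ => ?_
    simp; ring
  have h3 : ∑ j, ((1 : NNReal) : ℝ) * t j * l • ξ j = l * (t ⬝ᵥ ξ) := by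
    rw [dotProduct, Finset.mul_sum]
    refine Finset.sum_congr rfl fun j _ => ?_
    simp; ring
  rw [h1, h2, h3, ← hsdef, mul_pow l, hl, pow_succ s e,
    Real.sqrt_mul (show 0 ≤ s ^ e by positivity) s, mul_inv]
  have h4 : ((e + 1 : ℕ) : ℝ) * ((e : ℝ) * s ^ (e - 1) * (t ⬝ᵥ ξ) * (t ⬝ᵥ ξ) + s ^ e * (ξ ⬝ᵥ ξ)) -
      (((e + 1 : ℕ) : ℝ) * s ^ e * (t ⬝ᵥ ξ)) ^ 2 / (s ^ e * s) =
      ((e + 1 : ℕ) : ℝ) * s ^ e * (ξ ⬝ᵥ ξ) - ((e + 1 : ℕ) : ℝ) * s ^ e * (t ⬝ᵥ ξ) ^ 2 / s := by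
    rcases e with _ | e
    · simp
    · simp only [add_tsub_cancel_right]
      push_cast
      field_simp
      ring
  simp only [mul_assoc] at h4 ⊢
  rw [h4]
  ring

end Kernel

section Determinant

variable {J : Type*} [Fintype J] {m d : ℕ}

theorem pi_ennreal_smul_const (r : ENNReal) (hr : r ≠ ⊤) {α : Type*} [MeasurableSpace α]
    (ν : Measure α) [IsFiniteMeasure ν] :
    Measure.pi (fun _ : Fin m => r • ν) = r ^ m • Measure.pi fun _ : Fin m => ν := by
  have := Measure.smul_finite ν hr
  refine Measure.pi_eq fun s _ => ?_
  rw [Measure.smul_apply, Measure.pi_pi]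
  simp [Finset.prod_mul_distrib]

/-- The unnormalised expectation of `|det|` of the gradient matrix of a Gaussian system,
conditionally on the vanishing of the system. -/
theorem lintegral_pi_tiltedGaussian (c : J → NNReal) (q : J → ℝ) (g : J → Fin m → ℝ)
    {F : (Fin m → Fin m → ℝ) → ENNReal} (hF : Measurable F) :
    ∫⁻ w : Fin m → J → ℝ, F (fun l k => ∑ j, w l j * g j k) *
        ∏ l, gaussianPDF 0 1 (∑ j, w l j * q j)
      ∂(Measure.pi fun _ => Measure.pi fun j => gaussianReal 0 (c j)) =
      ∫⁻ B, F B ∂(Measure.pi fun _ : Fin m => tiltedGaussian c q g) := by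
  unfold tiltedGaussian
  rw [← Measure.pi_map_pi (fun _ => Measurable.aemeasurable (by fun_prop)),
    lintegral_map hF (by fun_prop), pi_withDensity (fun _ => by fun_prop),
    lintegral_withDensity_eq_lintegral_mul _ (by fun_prop) (by fun_prop)]
  refine lintegral_congr fun w => ?_
  simp [mul_comm]

theorem measurable_ofReal_abs_det :
    Measurable fun B : Fin m → Fin m → ℝ => ENNReal.ofReal |(Matrix.of B).det| := by
  have hcont : Continuous fun B : Fin m → Fin m → ℝ => (Matrix.of B).det :=
    Continuous.matrix_det (A := fun B : Fin m → Fin m → ℝ => Matrix.of B) continuous_id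
  exact (continuous_abs.comp hcont).measurable.ennreal_ofReal

theorem lintegral_det_eq_of_kernel (hd : 1 ≤ d) {c : J → NNReal} {f : J → (Fin m → ℝ) → ℝ}
    (hf : ∀ j, Differentiable ℝ (f j))
    (hK : ∀ x y, 1 + ∑ j, (c j : ℝ) * f j x * f j y = (1 + x ⬝ᵥ y) ^ d) (t : Fin m → ℝ) :
    ∫⁻ w : Fin m → J → ℝ,
        ENNReal.ofReal |(Matrix.of fun l k => ∑ j, w l j * fderiv ℝ (f j) t (Pi.single k 1)).det| *
        ∏ l, gaussianPDF 0 1 (∑ j, w l j * f j t)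
      ∂(Measure.pi fun _ => Measure.pi fun j => gaussianReal 0 (c j)) =
      ENNReal.ofReal (√d ^ m) * ∫⁻ A : Fin m → Fin m → ℝ, ENNReal.ofReal |(Matrix.of A).det| *
        ∏ l, gaussianPDF 0 1 (∑ k, A l k * t k)
      ∂(Measure.pi fun _ => Measure.pi fun _ => gaussianReal 0 1) := by
  rw [lintegral_pi_tiltedGaussian c (fun j => f j t)
      (fun j k => fderiv ℝ (f j) t (Pi.single k 1)) measurable_ofReal_abs_det,
    tiltedGaussian_eq_of_kernel hd hf hK, pi_ennreal_smul_const _ ENNReal.ofReal_ne_top,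
    lintegral_smul_measure, ← lintegral_pi_tiltedGaussian _ _ _ measurable_ofReal_abs_det]
  have hs : 0 < 1 + t ⬝ᵥ t := by
    have : 0 ≤ t ⬝ᵥ t := Finset.sum_nonneg fun i _ => mul_self_nonneg _
    linarith
  set p := (1 + t ⬝ᵥ t) ^ (d - 1) with hp
  have hp0 : 0 < p := by positivity
  have hdet : ∀ A : Fin m → Fin m → ℝ,
      ENNReal.ofReal |(Matrix.of fun l k => ∑ j, A l j *
        (√(d * p) • (Pi.single j 1 : Fin m → ℝ)) k).det| =
      ENNReal.ofReal (√(d * p) ^ m) * ENNReal.ofReal |(Matrix.of A).det| := by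
    intro A
    have : (Matrix.of fun l k => ∑ j, A l j * (√(d * p) • (Pi.single j 1 : Fin m → ℝ)) k) =
        √(d * p) • Matrix.of A := by
      ext l k
      simp [Pi.single_apply, mul_comm]
    rw [this, Matrix.det_smul, Fintype.card_fin, abs_mul, abs_of_nonneg (by positivity),
      ENNReal.ofReal_mul (by positivity)]
  have hm : Measurable fun A : Fin m → Fin m → ℝ => ENNReal.ofReal |(Matrix.of A).det| *
      ∏ l, gaussianPDF 0 1 (∑ k, A l k * t k) := measurable_ofReal_abs_det.mul (by fun_prop)
  simp_rw [hdet, mul_assoc]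
  rw [lintegral_const_mul _ hm, smul_eq_mul, ← mul_assoc,
    ← ENNReal.ofReal_pow (by positivity), ← ENNReal.ofReal_mul (by positivity)]
  congr 2
  rw [Real.sqrt_mul (by positivity), mul_pow, inv_pow]
  field_simp

/-- Singular matrices form a Lebesgue null set. -/
theorem volume_det_eq_zero :
    volume {A : Fin m → Fin m → ℝ | (Matrix.of A).det = 0} = 0 := by
  set Z := {A : Fin m → Fin m → ℝ | (Matrix.of A).det = 0} with hZ
  have hcont : Continuous fun A : Fin m → Fin m → ℝ => (Matrix.of A).det :=
    Continuous.matrix_det (A := fun B : Fin m → Fin m → ℝ => Matrix.of B) continuous_id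
  have hZm : MeasurableSet Z := hcont.measurable (measurableSet_singleton 0)
  let e : ℝ → Fin m → Fin m → ℝ := fun x => x • (1 : Matrix (Fin m) (Fin m) ℝ)
  have he : Measurable e := by
    have : Continuous e := continuous_id.smul continuous_const
    exact this.measurable
  have hS : MeasurableSet {p : (Fin m → Fin m → ℝ) × ℝ | p.1 + e p.2 ∈ Z} :=
    (measurable_fst.add (he.comp measurable_snd)) hZm
  have h1 : (volume : Measure (Fin m → Fin m → ℝ)).prod (gaussianReal 0 1)
      {p : (Fin m → Fin m → ℝ) × ℝ | p.1 + e p.2 ∈ Z} = 0 := by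
    rw [Measure.measure_prod_null hS]
    refine ae_of_all _ fun A => ?_
    have hfin : {x : ℝ | A + e x ∈ Z}.Finite := by
      have hne : (Matrix.charpoly (-(Matrix.of A))) ≠ 0 := (Matrix.charpoly_monic _).ne_zero
      refine ((Matrix.charpoly (-(Matrix.of A))).roots.toFinset.finite_toSet).subset ?_
      intro x hx
      simp only [Finset.mem_coe, Multiset.mem_toFinset, Polynomial.mem_roots hne,
        Polynomial.IsRoot.def, Matrix.eval_charpoly]
      have : (Matrix.scalar (Fin m) x - -(Matrix.of A)) = Matrix.of (A + e x) := by
        ext i j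
        change Matrix.diagonal (fun _ => x) i j - -A i j =
          A i j + x * (1 : Matrix (Fin m) (Fin m) ℝ) i j
        simp [Matrix.diagonal_apply, Matrix.one_apply, add_comm]
      rw [this]
      exact hx
    have hna : NullSingletonClass (gaussianReal 0 1) :=
      nullSingletonClass_gaussianReal one_ne_zero
    exact hfin.measure_zero _
  rw [Measure.prod_apply_symm hS] at h1
  have h2 : ∀ x : ℝ, volume ((fun A => (A, x)) ⁻¹'
      {p : (Fin m → Fin m → ℝ) × ℝ | p.1 + e p.2 ∈ Z}) = volume Z := by
    intro x
    exact measure_preimage_add_right volume (e x) Z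
  simp_rw [h2] at h1
  simpa using h1

theorem lintegral_gaussianPDF_comp_mulVec (A : Matrix (Fin m) (Fin m) ℝ) (hA : A.det ≠ 0) :
    ∫⁻ t : Fin m → ℝ, ENNReal.ofReal |A.det| * ∏ l, gaussianPDF 0 1 (∑ k, A l k * t k) = 1 := by
  have h := Real.map_matrix_volume_pi_eq_smul_volume_pi hA
  have hG : Measurable fun y : Fin m → ℝ => ∏ l, gaussianPDF 0 1 (y l) := by fun_prop
  have h1 : ∫⁻ t : Fin m → ℝ, ∏ l, gaussianPDF 0 1 (∑ k, A l k * t k) =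
      ENNReal.ofReal |A.det⁻¹| := by
    have : ∫⁻ t : Fin m → ℝ, ∏ l, gaussianPDF 0 1 (∑ k, A l k * t k) =
        ∫⁻ y, ∏ l, gaussianPDF 0 1 (y l) ∂(Measure.map (Matrix.toLin' A) volume) := by
      rw [lintegral_map hG (LinearMap.continuous_of_finiteDimensional _).measurable]
      rfl
    rw [this, h, lintegral_smul_measure, volume_pi,
      lintegral_pi_prod (fun _ => measurable_gaussianPDF 0 1)]
    simp [lintegral_gaussianPDF_eq_one]
  rw [lintegral_const_mul _ (by fun_prop), h1, ← ENNReal.ofReal_mul (by positivity), ← abs_mul,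
    mul_inv_cancel₀ hA]
  simp

/-- The linear Gaussian system has exactly one root on average. -/
theorem lintegral_lintegral_det_linear :
    ∫⁻ t : Fin m → ℝ, ∫⁻ A : Fin m → Fin m → ℝ, ENNReal.ofReal |(Matrix.of A).det| *
        ∏ l, gaussianPDF 0 1 (∑ k, A l k * t k)
      ∂(Measure.pi fun _ => Measure.pi fun _ => gaussianReal 0 1) = 1 := by
  have hAm : Measurable fun p : (Fin m → ℝ) × (Fin m → Fin m → ℝ) =>
      ENNReal.ofReal |(Matrix.of p.2).det| := measurable_ofReal_abs_det.comp measurable_snd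
  rw [lintegral_lintegral_swap]
  swap
  · exact (hAm.mul (by fun_prop)).aemeasurable
  have hac : (Measure.pi fun _ : Fin m => Measure.pi fun _ : Fin m => gaussianReal 0 1) ≪
      volume := by
    have h1 : (Measure.pi fun _ : Fin m => gaussianReal 0 1) =
        volume.withDensity fun x => ∏ i, gaussianPDF 0 1 (x i) := by
      have : IsProbabilityMeasure (gaussianReal 0 1) := inferInstance
      rw [gaussianReal_of_var_ne_zero 0 one_ne_zero] at this ⊢
      exact pi_withDensity fun _ => measurable_gaussianPDF 0 1
    have hP : IsProbabilityMeasure (Measure.pi fun _ : Fin m => gaussianReal 0 1) := inferInstance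
    rw [h1] at hP ⊢
    rw [pi_withDensity fun _ => by fun_prop]
    exact withDensity_absolutelyContinuous _ _
  have hdet : ∀ᵐ A : Fin m → Fin m → ℝ
      ∂(Measure.pi fun _ => Measure.pi fun _ => gaussianReal 0 1), (Matrix.of A).det ≠ 0 :=
    hac.ae_le (measure_eq_zero_iff_ae_notMem.1 volume_det_eq_zero)
  have h : ∀ᵐ A : Fin m → Fin m → ℝ ∂(Measure.pi fun _ => Measure.pi fun _ => gaussianReal 0 1),
      ∫⁻ t : Fin m → ℝ, ENNReal.ofReal |(Matrix.of A).det| *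
        ∏ l, gaussianPDF 0 1 (∑ k, A l k * t k) = 1 :=
    hdet.mono fun A hA => lintegral_gaussianPDF_comp_mulVec (Matrix.of A) hA
  rw [lintegral_congr_ae h]
  simp

end Determinant

section ZeroSet

theorem LinearMap.det_eq_of_fst_eq {V W : Type*} [AddCommGroup V] [Module ℝ V]
    [FiniteDimensional ℝ V] [AddCommGroup W] [Module ℝ W] [FiniteDimensional ℝ W]
    (T : V × W →ₗ[ℝ] V × W) (A : W →ₗ[ℝ] W) (h₁ : ∀ p, (T p).1 = p.1)
    (h₂ : ∀ u, (T (0, u)).2 = A u) : LinearMap.det T = LinearMap.det A := by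
  classical
  let b := Module.finBasis ℝ V
  let b' := Module.finBasis ℝ W
  have h : LinearMap.toMatrix (b.prod b') (b.prod b') T = Matrix.fromBlocks 1 0
      (Matrix.of fun i j => b'.repr (T (b j, 0)).2 i) (LinearMap.toMatrix b' b' A) := by
    ext i j
    rcases i with i | i <;> rcases j with j | j <;>
      simp [LinearMap.toMatrix_apply, h₁, h₂, Matrix.one_apply, Finsupp.single_apply, eq_comm]
  rw [← LinearMap.det_toMatrix (b.prod b'), h, Matrix.det_fromBlocks_zero₁₂, Matrix.det_one,
    one_mul, LinearMap.det_toMatrix]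

variable {J : Type*} [Fintype J] {m d : ℕ}

/-- The map whose fibre over `(w, a)` is the zero set of the random system
`a ℓ + ∑ j, w ℓ j * f j t = 0`. -/
def incidenceMap (f : J → (Fin m → ℝ) → ℝ) (p : (Fin m → J → ℝ) × (Fin m → ℝ)) :
    (Fin m → J → ℝ) × (Fin m → ℝ) :=
  (p.1, fun l => -∑ j, p.1 l j * f j p.2)

theorem contDiff_incidenceMap {f : J → (Fin m → ℝ) → ℝ} (hf : ∀ j, ContDiff ℝ 1 (f j)) :
    ContDiff ℝ 1 (incidenceMap f) := by
  unfold incidenceMap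
  refine contDiff_fst.prodMk (contDiff_pi.2 fun l => (ContDiff.sum fun j _ => ?_).neg)
  refine ContDiff.mul ?_ ((hf j).comp contDiff_snd)
  exact (contDiff_apply_apply ℝ ℝ l j).comp contDiff_fst

theorem abs_det_fderiv_incidenceMap {f : J → (Fin m → ℝ) → ℝ} (hf : ∀ j, ContDiff ℝ 1 (f j))
    (p : (Fin m → J → ℝ) × (Fin m → ℝ)) :
    |(fderiv ℝ (incidenceMap f) p).det| =
      |(Matrix.of fun l k => ∑ j, p.1 l j * fderiv ℝ (f j) p.2 (Pi.single k 1)).det| := by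
  have hd : HasFDerivAt (incidenceMap f) (fderiv ℝ (incidenceMap f) p) p :=
    ((contDiff_incidenceMap hf).differentiable one_ne_zero p).hasFDerivAt
  set M : Matrix (Fin m) (Fin m) ℝ :=
    Matrix.of fun l k => ∑ j, p.1 l j * fderiv ℝ (f j) p.2 (Pi.single k 1) with hM
  have h₁ : ∀ q, ((fderiv ℝ (incidenceMap f) p) q).1 = q.1 := by
    have h : (ContinuousLinearMap.fst ℝ _ _).comp (fderiv ℝ (incidenceMap f) p) =
        ContinuousLinearMap.fst ℝ _ _ := hd.fst.unique hasFDerivAt_fst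
    exact fun q => DFunLike.congr_fun h q
  have h₂ : ∀ u, ((fderiv ℝ (incidenceMap f) p) (0, u)).2 = Matrix.toLin' (-M) u := by
    intro u
    ext l
    have hline : HasDerivAt (fun ε : ℝ => p + ε • ((0, u) : (Fin m → J → ℝ) × (Fin m → ℝ)))
        (0, u) 0 := by
      simpa using ((hasDerivAt_id (0 : ℝ)).smul_const
        ((0, u) : (Fin m → J → ℝ) × (Fin m → ℝ))).const_add p
    have hline' : HasDerivAt (fun ε : ℝ => p.2 + ε • u) u 0 := by
      simpa using ((hasDerivAt_id (0 : ℝ)).smul_const u).const_add p.2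
    have e₁ : HasDerivAt (fun ε : ℝ => (incidenceMap f (p + ε • ((0, u) :
        (Fin m → J → ℝ) × (Fin m → ℝ)))).2 l) (((fderiv ℝ (incidenceMap f) p) (0, u)).2 l) 0 := by
      have := HasFDerivAt.comp_hasDerivAt (0 : ℝ) (by simpa using hd) hline
      exact hasDerivAt_pi.1 this.snd l
    have e₂ : HasDerivAt (fun ε : ℝ => -∑ j, p.1 l j * f j (p.2 + ε • u))
        (-∑ j, p.1 l j * fderiv ℝ (f j) p.2 u) 0 := by
      refine (HasDerivAt.fun_sum fun j _ => HasDerivAt.const_mul _ ?_).neg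
      exact HasFDerivAt.comp_hasDerivAt (0 : ℝ)
        (by simpa using ((hf j).differentiable one_ne_zero p.2).hasFDerivAt) hline'
    have e₃ := e₁.unique (by simpa [incidenceMap] using e₂)
    rw [e₃, Matrix.toLin'_apply, Matrix.neg_mulVec, Pi.neg_apply, Matrix.mulVec, dotProduct]
    simp only [hM, Matrix.of_apply, Finset.sum_mul]
    rw [Finset.sum_comm]
    congr 1
    refine Finset.sum_congr rfl fun j _ => ?_
    conv_lhs => rw [← Finset.univ_sum_single u, map_sum]
    rw [Finset.mul_sum]
    refine Finset.sum_congr rfl fun k _ => ?_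
    have : (Pi.single k (u k) : Fin m → ℝ) = u k • Pi.single k 1 := by simp [← Pi.single_smul]
    rw [this, map_smul, smul_eq_mul]
    ring
  have h := LinearMap.det_eq_of_fst_eq (fderiv ℝ (incidenceMap f) p).toLinearMap _ h₁ h₂
  rw [ContinuousLinearMap.det, h, LinearMap.det_toLin', Matrix.det_neg, abs_mul]
  simp

/-- The Gaussian measure with all variances nonzero, as a density. -/
theorem pi_gaussianReal_eq_withDensity {ι : Type*} [Fintype ι] {c : ι → NNReal}
    (hc : ∀ i, c i ≠ 0) :
    Measure.pi (fun i => gaussianReal 0 (c i)) =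
      volume.withDensity fun x => ∏ i, gaussianPDF 0 (c i) (x i) := by
  have h : ∀ i, gaussianReal 0 (c i) = volume.withDensity (gaussianPDF 0 (c i)) :=
    fun i => gaussianReal_of_var_ne_zero 0 (hc i)
  have : ∀ i, SigmaFinite (volume.withDensity (gaussianPDF 0 (c i))) := fun i => by
    rw [← h i]; infer_instance
  simp_rw [h]
  exact pi_withDensity fun i => measurable_gaussianPDF 0 (c i)

theorem lintegral_count_incidenceMap (hd : 1 ≤ d) {c : J → NNReal} (hc : ∀ j, c j ≠ 0)
    {f : J → (Fin m → ℝ) → ℝ} (hf : ∀ j, ContDiff ℝ 1 (f j))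
    (hK : ∀ x y, 1 + ∑ j, (c j : ℝ) * f j x * f j y = (1 + x ⬝ᵥ y) ^ d) :
    AEMeasurable (fun y => Measure.count (incidenceMap f ⁻¹' {y}))
      ((Measure.pi fun _ => Measure.pi fun j => gaussianReal 0 (c j)).prod
        (Measure.pi fun _ => gaussianReal 0 1)) ∧
    ∫⁻ y, Measure.count (incidenceMap f ⁻¹' {y})
      ∂((Measure.pi fun _ => Measure.pi fun j => gaussianReal 0 (c j)).prod
        (Measure.pi fun _ => gaussianReal 0 1)) = ENNReal.ofReal (√d ^ m) := by
  set γ : Measure (Fin m → J → ℝ) := Measure.pi fun _ => Measure.pi fun j => gaussianReal 0 (c j)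
    with hγ
  let P : (Fin m → J → ℝ) → ENNReal := fun w => ∏ l, ∏ j, gaussianPDF 0 (c j) (w l j)
  let G : (Fin m → ℝ) → ENNReal := fun a => ∏ l, gaussianPDF 0 1 (a l)
  have hP : Measurable P := by fun_prop
  have hG : Measurable G := by fun_prop
  have hγP : γ = volume.withDensity P := by
    have h := pi_gaussianReal_eq_withDensity hc
    have : IsProbabilityMeasure (volume.withDensity
        fun x : J → ℝ => ∏ j, gaussianPDF 0 (c j) (x j)) := by rw [← h]; infer_instance
    rw [hγ, h, pi_withDensity fun _ => by fun_prop]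
    rfl
  have hN : (Measure.pi fun _ : Fin m => gaussianReal 0 1) = volume.withDensity G :=
    pi_gaussianReal_eq_withDensity fun _ => one_ne_zero
  have hprod : γ.prod (Measure.pi fun _ : Fin m => gaussianReal 0 1) =
      volume.withDensity fun y => P y.1 * G y.2 := by
    have : SigmaFinite (volume.withDensity G) := by rw [← hN]; infer_instance
    rw [hN, hγP, prod_withDensity hP hG]
    rfl
  have hg : Measurable fun y : (Fin m → J → ℝ) × (Fin m → ℝ) => P y.1 * G y.2 := by fun_prop
  have hΦ := contDiff_incidenceMap hf
  have hm : Measurable (fderiv ℝ (incidenceMap f)) :=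
    (hΦ.continuous_fderiv one_ne_zero).measurable
  have hvol : (volume : Measure (Fin m → J → ℝ)).IsAddHaarMeasure :=
    Measure.pi.isAddHaarMeasure fun _ : Fin m => (volume : Measure (J → ℝ))
  have hvol' : (volume : Measure ((Fin m → J → ℝ) × (Fin m → ℝ))).IsAddHaarMeasure :=
    Measure.prod.instIsAddHaarMeasure volume volume
  obtain ⟨hA, hI⟩ := lintegral_count_preimage_mul
    (volume : Measure ((Fin m → J → ℝ) × (Fin m → ℝ)))
    (fun x => (hΦ.differentiable one_ne_zero x).hasFDerivAt) hm hg
  rw [hprod]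
  refine ⟨hA.mono_ac (withDensity_absolutelyContinuous _ _), ?_⟩
  rw [lintegral_withDensity_eq_lintegral_mul₀ hg.aemeasurable hA]
  have hcond : Continuous fun p : (Fin m → J → ℝ) × (Fin m → ℝ) =>
      (Matrix.of fun l k => ∑ j, p.1 l j * fderiv ℝ (f j) p.2 (Pi.single k 1)).det := by
    refine Continuous.matrix_det (continuous_pi fun l => continuous_pi fun k =>
      continuous_finsetSum _ fun j _ => Continuous.mul ?_ ?_)
    · fun_prop
    · exact (((hf j).continuous_fderiv one_ne_zero).comp continuous_snd).clm_apply continuous_const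
  have hdm : Measurable fun p : (Fin m → J → ℝ) × (Fin m → ℝ) => ENNReal.ofReal
      |(Matrix.of fun l k => ∑ j, p.1 l j * fderiv ℝ (f j) p.2 (Pi.single k 1)).det| :=
    (continuous_abs.comp hcond).measurable.ennreal_ofReal
  have hfm : ∀ j, Measurable (f j) := fun j => (hf j).continuous.measurable
  have hQm : Measurable fun p : (Fin m → J → ℝ) × (Fin m → ℝ) =>
      ∏ l, gaussianPDF 0 1 (∑ j, p.1 l j * f j p.2) := by
    refine Finset.measurable_prod _ fun l _ => (measurable_gaussianPDF 0 1).comp ?_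
    exact Finset.measurable_sum _ fun j _ =>
      Measurable.mul (by fun_prop) ((hfm j).comp measurable_snd)
  have hFm : Measurable fun p : (Fin m → J → ℝ) × (Fin m → ℝ) => ENNReal.ofReal
      |(Matrix.of fun l k => ∑ j, p.1 l j * fderiv ℝ (f j) p.2 (Pi.single k 1)).det| *
        ∏ l, gaussianPDF 0 1 (∑ j, p.1 l j * f j p.2) := hdm.mul hQm
  have hPm : Measurable fun p : (Fin m → J → ℝ) × (Fin m → ℝ) => P p.1 * (ENNReal.ofReal
      |(Matrix.of fun l k => ∑ j, p.1 l j * fderiv ℝ (f j) p.2 (Pi.single k 1)).det| *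
        ∏ l, gaussianPDF 0 1 (∑ j, p.1 l j * f j p.2)) :=
    (hP.comp measurable_fst).mul hFm
  have heven : ∀ x : ℝ, gaussianPDF 0 1 (-x) = gaussianPDF 0 1 x := by
    intro x; simp [gaussianPDF, gaussianPDFReal]
  calc ∫⁻ y, (fun y : (Fin m → J → ℝ) × (Fin m → ℝ) => P y.1 * G y.2) y *
        Measure.count (incidenceMap f ⁻¹' {y})
      = ∫⁻ y, Measure.count (incidenceMap f ⁻¹' {y}) * (P y.1 * G y.2) :=
        lintegral_congr fun y => mul_comm _ _
    _ = ∫⁻ p : (Fin m → J → ℝ) × (Fin m → ℝ), P p.1 * (ENNReal.ofReal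
        |(Matrix.of fun l k => ∑ j, p.1 l j * fderiv ℝ (f j) p.2 (Pi.single k 1)).det| *
          ∏ l, gaussianPDF 0 1 (∑ j, p.1 l j * f j p.2)) := by
        rw [hI]
        refine lintegral_congr fun p => ?_
        rw [abs_det_fderiv_incidenceMap hf, mul_left_comm]
        simp only [incidenceMap, G, heven]
    _ = ∫⁻ t, ∫⁻ w, ENNReal.ofReal
        |(Matrix.of fun l k => ∑ j, w l j * fderiv ℝ (f j) t (Pi.single k 1)).det| *
          ∏ l, gaussianPDF 0 1 (∑ j, w l j * f j t) ∂γ := by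
        rw [Measure.volume_eq_prod, lintegral_prod_symm' _ hPm]
        refine lintegral_congr fun t => ?_
        have hFt := hFm.comp (measurable_prodMk_right (y := t))
        simp only [Function.comp_def] at hFt
        rw [hγP, lintegral_withDensity_eq_lintegral_mul _ hP hFt]
        rfl
    _ = ENNReal.ofReal (√d ^ m) := by
        simp_rw [hγ, lintegral_det_eq_of_kernel hd
          (fun j => (hf j).differentiable one_ne_zero) hK]
        rw [lintegral_const_mul', lintegral_lintegral_det_linear, mul_one]
        exact ENNReal.ofReal_ne_top

end ZeroSet

section Coefficients

variable {m d : ℕ}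

/-- The multi-indices `j ∈ ℕ^m` with `|j| ≤ d`. -/
abbrev KssMultiIndex (m d : ℕ) := {j : Fin m → Fin (d + 1) // (∑ k, (j k : ℕ)) ≤ d}

/-- The variance `d! / (j_1! ⋯ j_m! (d - |j|)!)` attached to a multi-index. -/
noncomputable def kssMultinomial (j : KssMultiIndex m d) : NNReal :=
  (d ! : NNReal) / ((∏ k, ((j.1 k : ℕ))! : ℕ) * ((d - ∑ k, (j.1 k : ℕ))! : ℕ))

theorem kssMultinomial_ne_zero (j : KssMultiIndex m d) : kssMultinomial j ≠ 0 := by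
  have h : (∏ k, ((j.1 k : ℕ))!) ≠ 0 := Finset.prod_ne_zero_iff.2 fun k _ => factorial_ne_zero _
  refine div_ne_zero (by exact_mod_cast factorial_ne_zero d) (mul_ne_zero ?_ ?_)
  · exact_mod_cast h
  · exact_mod_cast factorial_ne_zero _

/-- The multi-index `0`. -/
def kssZero (m d : ℕ) : KssMultiIndex m d := ⟨fun _ => 0, by simp⟩

theorem kssMultinomial_kssZero : kssMultinomial (kssZero m d) = 1 := by
  have : (d ! : NNReal) ≠ 0 := by exact_mod_cast factorial_ne_zero d
  simp [kssMultinomial, kssZero, this]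

/-- The multinomial theorem, in terms of `KssMultiIndex`. -/
theorem sum_kssMultinomial (z : Fin m → ℝ) :
    ∑ j : KssMultiIndex m d, (kssMultinomial j : ℝ) * ∏ k, z k ^ (j.1 k : ℕ) =
      (1 + ∑ k, z k) ^ d := by
  have hz : 1 + ∑ k, z k = ∑ o : Option (Fin m), o.elim 1 z := by simp [Fintype.sum_option]
  rw [hz, Finset.sum_pow_eq_sum_piAntidiag]
  refine Finset.sum_bij
    (fun j _ o => Option.elim o (d - ∑ k, (j.1 k : ℕ)) fun k => (j.1 k : ℕ)) ?_ ?_ ?_ ?_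
  · intro j _
    rw [Finset.mem_piAntidiag]
    refine ⟨?_, by simp⟩
    simpa [Fintype.sum_option] using Nat.sub_add_cancel j.2
  · intro i _ j _ h
    ext k
    simpa using congrFun h (some k)
  · intro b hb
    rw [Finset.mem_piAntidiag, Fintype.sum_option] at hb
    have hle : ∀ k, b (some k) ≤ ∑ k, b (some k) := fun k =>
      Finset.single_le_sum (f := fun k => b (some k)) (fun _ _ => Nat.zero_le _)
        (Finset.mem_univ k)
    refine ⟨⟨fun k => ⟨b (some k), ?_⟩, ?_⟩, Finset.mem_univ _, ?_⟩
    · have := hle k; omega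
    · change ∑ k, b (some k) ≤ d
      omega
    · ext o
      rcases o with _ | k
      · change d - ∑ k, b (some k) = b none
        omega
      · rfl
  · intro j _
    have hs := Nat.multinomial_spec Finset.univ
      (fun o : Option (Fin m) => Option.elim o (d - ∑ k, (j.1 k : ℕ)) fun k => (j.1 k : ℕ))
    simp only [Fintype.sum_option, Fintype.prod_option, Option.elim, Nat.sub_add_cancel j.2] at hs ⊢
    have h1 : ((d - ∑ k, (j.1 k : ℕ))! : ℝ) ≠ 0 := by exact_mod_cast factorial_ne_zero _
    have h2 : ((∏ k, ((j.1 k : ℕ))! : ℕ) : ℝ) ≠ 0 := by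
      exact_mod_cast Finset.prod_ne_zero_iff.2 fun k _ => factorial_ne_zero _
    rw [one_pow, one_mul]
    congr 1
    rw [kssMultinomial, NNReal.coe_div, NNReal.coe_mul, NNReal.coe_natCast, NNReal.coe_natCast,
      NNReal.coe_natCast, div_eq_iff (mul_ne_zero h2 h1)]
    have hs' := congrArg (Nat.cast (R := ℝ)) hs
    push_cast at hs' ⊢
    linarith

/-- The monomial of a multi-index. -/
def kssMonomial (j : KssMultiIndex m d) (t : Fin m → ℝ) : ℝ := ∏ k, t k ^ (j.1 k : ℕ)

theorem contDiff_kssMonomial (j : KssMultiIndex m d) : ContDiff ℝ 1 (kssMonomial j) := by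
  unfold kssMonomial
  exact contDiff_prod fun k _ => (contDiff_apply ℝ ℝ k).pow _

theorem kernel_kssMonomial (x y : Fin m → ℝ) :
    1 + ∑ j : {j : KssMultiIndex m d // j ≠ kssZero m d},
      (kssMultinomial j.1 : ℝ) * kssMonomial j.1 x * kssMonomial j.1 y = (1 + x ⬝ᵥ y) ^ d := by
  rw [dotProduct, ← sum_kssMultinomial, Fintype.sum_eq_add_sum_subtype_ne _ (kssZero m d),
    kssMultinomial_kssZero]
  congr 1
  · simp [kssZero]
  · refine Finset.sum_congr rfl fun j _ => ?_
    simp only [kssMonomial, mul_pow, Finset.prod_mul_distrib, mul_assoc]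

/-- Separates the constant coefficients from the others. -/
def kssSplit (ω : kssIndex m d → ℝ) :
    (Fin m → {j : KssMultiIndex m d // j ≠ kssZero m d} → ℝ) × (Fin m → ℝ) :=
  (fun l j => ω (l, j.1), fun l => ω (l, kssZero m d))

theorem measurable_kssSplit : Measurable (kssSplit (m := m) (d := d)) := by
  unfold kssSplit; fun_prop

theorem map_kssSplit_kssMeasure :
    (kssMeasure m d).map kssSplit =
      (Measure.pi fun _ => Measure.pi fun j : {j : KssMultiIndex m d // j ≠ kssZero m d} =>
        gaussianReal 0 (kssMultinomial j.1)).prod (Measure.pi fun _ => gaussianReal 0 1) := by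
  let merge : (Fin m → {j : KssMultiIndex m d // j ≠ kssZero m d} → ℝ) × (Fin m → ℝ) →
      kssIndex m d → ℝ :=
    fun p i => if h : i.2 = kssZero m d then p.2 i.1 else p.1 i.1 ⟨i.2, h⟩
  have hmerge : Measurable merge := by
    refine measurable_pi_lambda _ fun i => ?_
    by_cases h : i.2 = kssZero m d
    · simp only [merge, dif_pos h]; fun_prop
    · simp only [merge, dif_neg h]; fun_prop
  have hsplit : kssSplit ∘ merge = id := by
    funext p
    refine Prod.ext (funext fun l => funext fun j => ?_) (funext fun l => ?_)
    · simp [kssSplit, merge, j.2]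
    · simp [kssSplit, merge]
  set μ := (Measure.pi fun _ : Fin m =>
      Measure.pi fun j : {j : KssMultiIndex m d // j ≠ kssZero m d} =>
        gaussianReal 0 (kssMultinomial j.1)).prod (Measure.pi fun _ : Fin m => gaussianReal 0 1)
    with hμ
  have hmap : kssMeasure m d = μ.map merge := by
    refine Measure.pi_eq fun s hs => ?_
    have hpre : merge ⁻¹' (Set.univ.pi s) =
        (Set.univ.pi fun l => Set.univ.pi fun j : {j // j ≠ kssZero m d} => s (l, j.1)) ×ˢ
          (Set.univ.pi fun l => s (l, kssZero m d)) := by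
      ext p
      simp only [Set.mem_preimage, Set.mem_univ_pi, Set.mem_prod]
      refine ⟨fun h => ⟨fun l j => ?_, fun l => ?_⟩, fun h i => ?_⟩
      · simpa [merge, j.2] using h (l, j.1)
      · simpa [merge] using h (l, kssZero m d)
      · obtain ⟨l, j⟩ := i
        by_cases hj : j = kssZero m d
        · subst hj
          simpa [merge] using h.2 l
        · simpa [merge, hj] using h.1 l ⟨j, hj⟩
    rw [Measure.map_apply hmerge (.univ_pi hs), hpre, hμ, Measure.prod_prod, Measure.pi_pi,
      Measure.pi_pi, Fintype.prod_prod_type, ← Finset.prod_mul_distrib]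
    refine Finset.prod_congr rfl fun l _ => ?_
    rw [Measure.pi_pi, Fintype.prod_eq_mul_prod_subtype_ne _ (kssZero m d), mul_comm]
    congr 2
    change _ = gaussianReal 0 (kssMultinomial (kssZero m d))
    rw [kssMultinomial_kssZero]
  rw [hmap, Measure.map_map measurable_kssSplit hmerge, hsplit, Measure.map_id]

theorem kssCount_eq_toReal_count (ω : kssIndex m d → ℝ) :
    (kssCount m d ω : ℝ) = (Measure.count (incidenceMap
      (fun j : {j : KssMultiIndex m d // j ≠ kssZero m d} => kssMonomial j.1) ⁻¹'
        {kssSplit ω})).toReal := by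
  set f := fun j : {j : KssMultiIndex m d // j ≠ kssZero m d} => kssMonomial j.1 with hf
  have hpre : incidenceMap f ⁻¹' {kssSplit ω} =
      (fun t => ((kssSplit ω).1, t)) '' {t : Fin m → ℝ | ∀ ℓ, kssPoly m d ω ℓ t = 0} := by
    have hP : ∀ l t, kssPoly m d ω l t =
        ω (l, kssZero m d) + ∑ j : {j // j ≠ kssZero m d}, ω (l, j.1) * f j t := by
      intro l t
      rw [kssPoly, Fintype.sum_eq_add_sum_subtype_ne _ (kssZero m d)]
      congr 1
      simp [kssZero]
    ext ⟨w, t⟩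
    simp only [Set.mem_preimage, Set.mem_singleton_iff, Set.mem_image, Set.mem_ofPred_eq,
      incidenceMap, Prod.ext_iff, hP]
    constructor
    · rintro ⟨rfl, h⟩
      refine ⟨t, fun l => ?_, rfl, rfl⟩
      have := congrFun h l
      simp only [kssSplit] at this
      linarith
    · rintro ⟨_, h, rfl, rfl⟩
      refine ⟨rfl, funext fun l => ?_⟩
      have := h l
      simp only [kssSplit]
      linarith
  have hcd : ∀ j, ContDiff ℝ 1 (f j) := fun j => contDiff_kssMonomial j.1
  have hcont : Continuous (incidenceMap f) := (contDiff_incidenceMap hcd).continuous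
  have hm : MeasurableSet (incidenceMap f ⁻¹' {kssSplit ω}) :=
    (isClosed_singleton.preimage hcont).measurableSet
  rw [Measure.count_apply hm, hpre,
    (Prod.mk_right_injective (kssSplit ω).1).injOn.encard_image, kssCount, Set.ncard]
  cases h : Set.encard {t : Fin m → ℝ | ∀ ℓ, kssPoly m d ω ℓ t = 0} <;> simp

end Coefficients

/-- Shub–Smale: the expected number of real roots of the `m × m` KSS system of degree
`d > 1` equals `d^{m/2}`. -/
theorem kss_expectation (m d : ℕ) (hm : 1 ≤ m) (hd : 1 < d) :
    ∫ ω, (kssCount m d ω : ℝ) ∂(kssMeasure m d) = (d : ℝ) ^ ((m : ℝ) / 2) := by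
  obtain ⟨hA, hI⟩ := lintegral_count_incidenceMap hd.le
    (fun j : {j : KssMultiIndex m d // j ≠ kssZero m d} => kssMultinomial_ne_zero j.1)
    (fun j => contDiff_kssMonomial j.1) kernel_kssMonomial
  rw [← map_kssSplit_kssMeasure] at hA hI
  rw [lintegral_map' hA measurable_kssSplit.aemeasurable] at hI
  have hA' := hA.comp_measurable measurable_kssSplit
  simp only [Function.comp_def] at hA'
  simp_rw [kssCount_eq_toReal_count]
  rw [integral_toReal hA' (ae_lt_top' hA' (hI ▸ ENNReal.ofReal_ne_top)), hI,
    ENNReal.toReal_ofReal (by positivity), Real.sqrt_eq_rpow, ← Real.rpow_natCast,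
    ← Real.rpow_mul (by positivity)]
  congr 1
  ring
end
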